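/- arXiv:1905.02893 — 9 statements merged into one kernel-verified Lean document; each statement's English description precedes it below -/
import Mathlib

section
/- Let n ≥ 2 and r ≥ 2 be integers and let H = (V, E) be an n-uniform hypergraph with a finite edge set E. Then the number of r-chains in H (where a chain and its reversal are identified) is at most (|E|/2) · (|E|/(r-1))^(r-1). -/
/-- The vertex sequences of the induced paths with `k` steps of the relation `R` which start at `v`
and whose remaining vertices lie in `S`. -/
def inducedPathsFrom {α : Type*} (R : α → α → Prop) (k : ℕ) (S : Finset α) (v : α) :
    Set (Fin (k + 1) → α) :=
  {c | c 0 = v ∧ (∀ i : Fin k, c i.succ ∈ S) ∧ (∀ i : Fin k, R (c i.castSucc) (c i.succ)) ∧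
    ∀ i j : Fin (k + 1), (i : ℕ) + 2 ≤ j → ¬ R (c i) (c j)}

/-- The weighted inequality of arithmetic and geometric means, in polynomial form. -/
theorem pow_mul_sub_le_pow_succ {a y : ℝ} (ha : 0 ≤ a) (hy : 0 ≤ y) (k : ℕ) :
    y ^ k * ((k + 1) * a - k * y) ≤ a ^ (k + 1) := by
  induction k with
  | zero => simp
  | succ k ih =>
    have h₁ := mul_le_mul_of_nonneg_right ih ha
    have h₂ : 0 ≤ (k + 1) * y ^ k * (a - y) ^ 2 := by positivity
    calc y ^ (k + 1) * (((k + 1 : ℕ) + 1) * a - (k + 1 : ℕ) * y)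
        = y ^ k * ((k + 1) * a - k * y) * a - (k + 1) * y ^ k * (a - y) ^ 2 := by
          push_cast; ring
      _ ≤ a ^ (k + 1 + 1) := by rw [pow_succ a (k + 1)]; linarith

theorem mul_div_pow_le_add_div_pow_succ {d t : ℝ} (hd : 0 ≤ d) (ht : 0 ≤ t) (k : ℕ) :
    d * (t / k) ^ k ≤ ((d + t) / (k + 1 : ℕ)) ^ (k + 1) := by
  rcases k.eq_zero_or_pos with rfl | hk
  · simpa using ht
  · have hk' : (0 : ℝ) < k := by exact_mod_cast hk
    have h := pow_mul_sub_le_pow_succ (a := (d + t) / (k + 1 : ℕ)) (y := t / k)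
      (by positivity) (by positivity) k
    have e : ((k : ℝ) + 1) * ((d + t) / (k + 1 : ℕ)) - k * (t / k) = d := by
      push_cast; field_simp; ring
    rwa [e, mul_comm] at h

theorem inducedPathsFrom_succ_subset {α : Type*} (R : α → α → Prop) [DecidableRel R] (k : ℕ)
    (S : Finset α) (v : α) :
    inducedPathsFrom R (k + 1) S v ⊆ ⋃ w ∈ S.filter (R v),
      (Fin.cons (α := fun _ => α) v) ''
        inducedPathsFrom R k (S.filter fun w => ¬ R v w) w := by
  rintro c ⟨rfl, hS, hR, hN⟩
  simp only [Set.mem_iUnion]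
  refine ⟨c 1, Finset.mem_filter.2 ⟨hS 0, hR 0⟩, Fin.tail c, ⟨rfl, fun i => ?_, fun i => ?_,
    fun i j hij => ?_⟩, Fin.cons_self_tail c⟩
  · exact Finset.mem_filter.2 ⟨hS i.succ, hN 0 i.succ.succ (by simp)⟩
  · exact hR i.succ
  · exact hN i.succ j.succ (by simp only [Fin.val_succ]; omega)

theorem inducedPathsFrom_finite_and_ncard_le {α : Type*} (R : α → α → Prop) [DecidableRel R]
    (k : ℕ) (S : Finset α) (v : α) :
    (inducedPathsFrom R k S v).Finite ∧
      ((inducedPathsFrom R k S v).ncard : ℝ) ≤ ((S.card : ℝ) / k) ^ k := by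
  classical
  induction k generalizing S v with
  | zero =>
    have h : inducedPathsFrom R 0 S v ⊆ {fun _ => v} := by
      rintro c ⟨h, -⟩
      ext i
      rw [show i = 0 from Fin.fin_one_eq_zero i, h]
    refine ⟨(Set.finite_singleton _).subset h, ?_⟩
    have := Set.ncard_le_ncard h
    rw [Set.ncard_singleton] at this
    simpa using this
  | succ k ih =>
    set T := S.filter fun w => ¬ R v w
    have hfin : ∀ w, ((Fin.cons (α := fun _ => α) v) ''
        inducedPathsFrom R k T w).Finite := fun w => (ih T w).1.image _
    have hsub := inducedPathsFrom_succ_subset R k S v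
    have hU := (S.filter (R v)).finite_toSet.biUnion fun w _ => hfin w
    refine ⟨hU.subset hsub, ?_⟩
    have hcard : ((S.filter (R v)).card : ℝ) + T.card = S.card := by
      exact_mod_cast Finset.card_filter_add_card_filter_not (R v)
    calc ((inducedPathsFrom R (k + 1) S v).ncard : ℝ)
        ≤ ∑ w ∈ S.filter (R v), (((Fin.cons (α := fun _ => α) v) ''
            inducedPathsFrom R k T w).ncard : ℝ) := by
          exact_mod_cast (Set.ncard_le_ncard hsub hU).trans (Finset.set_ncard_biUnion_le _ _)
      _ ≤ ∑ w ∈ S.filter (R v), ((T.card : ℝ) / k) ^ k :=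
          Finset.sum_le_sum fun w _ =>
            (Nat.cast_le.2 (Set.ncard_image_le (ih T w).1)).trans (ih T w).2
      _ = (S.filter (R v)).card * ((T.card : ℝ) / k) ^ k := by simp
      _ ≤ _ := by
          rw [← hcard]
          exact mul_div_pow_le_add_div_pow_succ (Nat.cast_nonneg _) (Nat.cast_nonneg _) k

/-- Identifying the points of a finite set with their images under a fixed-point-free involution
at least halves the cardinality. -/
theorem two_mul_ncard_image_pair_le {α : Type*} {T : Set α} (hT : T.Finite) {f : α → α}
    (hf : ∀ c ∈ T, f c ∈ T) (hinv : ∀ c, f (f c) = c) (hne : ∀ c ∈ T, f c ≠ c) :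
    2 * ((fun c => ({c, f c} : Set α)) '' T).ncard ≤ T.ncard := by
  classical
  lift T to Finset α using hT
  rw [← Finset.coe_image (s := T), Set.ncard_coe_finset, Set.ncard_coe_finset]
  refine Finset.mul_card_image_le_card T 2 fun p hp => ?_
  obtain ⟨c, hc, rfl⟩ := Finset.mem_image.1 hp
  rw [← Finset.card_pair (hne c hc).symm]
  refine Finset.card_le_card fun x hx => ?_
  rcases Finset.mem_insert.1 hx with rfl | hx
  · exact Finset.mem_filter.2 ⟨hc, rfl⟩
  · rw [Finset.mem_singleton.1 hx]
    refine Finset.mem_filter.2 ⟨hf c hc, ?_⟩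
    simp only [hinv]
    exact Set.pair_comm _ _


/-- Let `n ≥ 2` and `r ≥ 2` and let `H = (V, E)` be an `n`-uniform
hypergraph with finite edge set `E`. Then the number of `r`-chains in `H`,
where a chain and its reversal are identified, is at most
`(|E|/2) · (|E|/(r-1))^(r-1)`. -/
theorem chain_count_le {V : Type*} [DecidableEq V] (n r : ℕ) (hn : 2 ≤ n) (hr : 2 ≤ r)
    (E : Finset (Finset V)) (hE : ∀ e ∈ E, e.card = n) :
    (Set.ncard {p : Set (Fin r → Finset V) | ∃ c : Fin r → Finset V,
        ((∀ i, c i ∈ E) ∧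
          (∀ i j : Fin r, ((i : ℤ) - (j : ℤ)).natAbs = 1 → (c i ∩ c j).card = 1) ∧
          (∀ i j : Fin r, 2 ≤ ((i : ℤ) - (j : ℤ)).natAbs → c i ∩ c j = ∅)) ∧
        p = {c, fun i => c (Fin.rev i)}} : ℝ)
      ≤ ((E.card : ℝ) / 2) * ((E.card : ℝ) / ((r : ℝ) - 1)) ^ (r - 1) := by
  classical
  obtain ⟨k, rfl⟩ : ∃ k, r = k + 1 := ⟨r - 1, by omega⟩
  set T : Set (Fin (k + 1) → Finset V) := {c | (∀ i, c i ∈ E) ∧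
    (∀ i j : Fin (k + 1), ((i : ℤ) - (j : ℤ)).natAbs = 1 → (c i ∩ c j).card = 1) ∧
    (∀ i j : Fin (k + 1), 2 ≤ ((i : ℤ) - (j : ℤ)).natAbs → c i ∩ c j = ∅)}
  let R : Finset V → Finset V → Prop := fun a b => (a ∩ b).card = 1
  have hsub : T ⊆ ⋃ v ∈ E, inducedPathsFrom R k E v := by
    rintro c ⟨hcE, hadj, hdisj⟩
    simp only [Set.mem_iUnion]
    refine ⟨c 0, hcE 0, rfl, fun i => hcE _, fun i => hadj _ _ ?_, fun i j hij h => ?_⟩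
    · simp only [Fin.val_castSucc, Fin.val_succ]
      omega
    · simp only [R, hdisj i j (by omega), Finset.card_empty] at h
      omega
  have hU : (⋃ v ∈ E, inducedPathsFrom R k E v).Finite :=
    E.finite_toSet.biUnion fun v _ => (inducedPathsFrom_finite_and_ncard_le R k E v).1
  have hcard : (T.ncard : ℝ) ≤ E.card * ((E.card : ℝ) / k) ^ k :=
    calc (T.ncard : ℝ) ≤ ∑ v ∈ E, ((inducedPathsFrom R k E v).ncard : ℝ) := by
          exact_mod_cast (Set.ncard_le_ncard hsub hU).trans (Finset.set_ncard_biUnion_le _ _)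
      _ ≤ ∑ v ∈ E, ((E.card : ℝ) / k) ^ k :=
          Finset.sum_le_sum fun v _ => (inducedPathsFrom_finite_and_ncard_le R k E v).2
      _ = _ := by simp
  have hhalf := two_mul_ncard_image_pair_le (hU.subset hsub) (f := fun c i => c (Fin.rev i))
    (by
      rintro c ⟨hcE, hadj, hdisj⟩
      refine ⟨fun i => hcE _, fun i j hij => hadj _ _ ?_, fun i j hij => hdisj _ _ ?_⟩ <;>
      · simp only [Fin.val_rev]
        omega)
    (fun c => by simp)
    (by
      rintro c ⟨hcE, hadj, hdisj⟩ h
      have hlast : c (Fin.last k) = c 0 := by simpa using congrFun h 0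
      have hn0 := hE _ (hcE 0)
      rcases Nat.lt_or_ge k 2 with hk | hk
      · have := hadj 0 (Fin.last k) (by simp only [Fin.val_zero, Fin.val_last]; omega)
        rw [hlast, Finset.inter_self] at this
        omega
      · have := hdisj 0 (Fin.last k) (by simp only [Fin.val_zero, Fin.val_last]; omega)
        rw [hlast, Finset.inter_self] at this
        rw [this, Finset.card_empty] at hn0
        omega)
  have himage : {p : Set (Fin (k + 1) → Finset V) | ∃ c, c ∈ T ∧ p = {c, fun i => c (Fin.rev i)}} =
      (fun c => ({c, fun i => c (Fin.rev i)} : Set (Fin (k + 1) → Finset V))) '' T := by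
    ext p
    simp only [Set.mem_image, Set.mem_ofPred_eq, eq_comm]
  rw [← himage] at hhalf
  have hk : ((k + 1 : ℕ) : ℝ) - 1 = k := by push_cast; ring
  rw [hk, Nat.add_sub_cancel, div_mul_eq_mul_div, le_div_iff₀ two_pos, mul_comm]
  refine le_trans ?_ hcard
  rw [← Nat.cast_two, ← Nat.cast_mul]
  exact Nat.cast_le.2 hhalf
end

section
/- Let G be a simple graph on n vertices and let r ≥ 2 be an integer. Then the number of induced subgraphs of G isomorphic to the path P_r on r vertices is at most (n/2) · (n/(r-1))^(r-1). -/
/-- A polynomial form of the inequality between arithmetic and geometric means. -/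
theorem succ_mul_mul_pow_le (x y : ℝ) (hx : 0 ≤ x) (hy : 0 ≤ y) (k : ℕ) :
    (k + 1) * y * x ^ k ≤ y ^ (k + 1) + k * x ^ (k + 1) := by
  induction k with
  | zero => simp
  | succ k ih =>
    have h1 := mul_le_mul_of_nonneg_left ih hy
    have h2 : 0 ≤ (k + 1) * x ^ k * (y - x) ^ 2 := by positivity
    push_cast
    ring_nf at h1 h2 ⊢
    linarith

theorem mul_div_pow_le (m a : ℝ) (ha : 0 ≤ a) (ham : a ≤ m) (k : ℕ) :
    a * ((m - a) / k) ^ k ≤ (m / (k + 1)) ^ (k + 1) := by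
  rcases Nat.eq_zero_or_pos k with rfl | hk
  · simpa using ham
  have hk' : (0 : ℝ) < k := by exact_mod_cast hk
  have hx : 0 ≤ (m - a) / k := div_nonneg (by linarith) hk'.le
  have hy : 0 ≤ m / (k + 1) := div_nonneg (by linarith) (by linarith)
  have h := succ_mul_mul_pow_le ((m - a) / k) (m / (k + 1)) hx hy k
  have ha' : a = (k + 1) * (m / (k + 1)) - k * ((m - a) / k) := by field_simp; ring
  calc a * ((m - a) / k) ^ k
      = ((k + 1) * (m / (k + 1)) - k * ((m - a) / k)) * ((m - a) / k) ^ k := by rw [← ha']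
    _ ≤ _ := by rw [sub_mul, mul_assoc (k : ℝ), ← pow_succ']; linarith

/-- The sequence `f` spans an induced path in `G`, in this order. -/
def IsInducedPathSeq {V : Type*} (G : SimpleGraph V) {k : ℕ} (f : Fin k → V) : Prop :=
  ∀ i j : Fin k, i < j → (G.Adj (f i) (f j) ↔ (i : ℕ) + 1 = j)

open Classical in
/-- The induced path sequences with `k` edges which start at `v` and continue inside `S`. -/
noncomputable def inducedPathSeqsFrom {V : Type*} [Fintype V] (G : SimpleGraph V) (k : ℕ)
    (S : Finset V) (v : V) : Finset (Fin (k + 1) → V) :=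
  {f | IsInducedPathSeq G f ∧ f 0 = v ∧ ∀ i : Fin k, f i.succ ∈ S}

open Classical in
theorem card_inducedPathSeqsFrom_succ_le {V : Type*} [Fintype V] (G : SimpleGraph V) (k : ℕ)
    (S : Finset V) (v : V) :
    (inducedPathSeqsFrom G (k + 1) S v).card ≤
      ∑ w ∈ S with G.Adj v w, (inducedPathSeqsFrom G k {w ∈ S | ¬ G.Adj v w} w).card := by
  refine le_trans (Finset.card_le_card_of_injOn
    (t := (S.filter (G.Adj v)).biUnion
      fun w => inducedPathSeqsFrom G k {w ∈ S | ¬ G.Adj v w} w) Fin.tail ?_ ?_)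
    Finset.card_biUnion_le
  · intro f hf
    simp only [inducedPathSeqsFrom, Finset.coe_filter, Finset.mem_univ, true_and,
      Set.mem_ofPred_eq] at hf
    obtain ⟨hp, rfl, hS⟩ := hf
    simp only [Finset.coe_biUnion, Set.mem_iUnion, inducedPathSeqsFrom, Finset.coe_filter,
      Finset.mem_filter, Finset.mem_univ, true_and, Set.mem_ofPred_eq]
    refine ⟨Fin.tail f 0, ⟨hS 0, (hp 0 (Fin.succ 0) (Fin.succ_pos _)).2 (by simp)⟩, ?_, rfl,
      fun i => ⟨hS _, fun h => ?_⟩⟩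
    · intro i j hij
      simpa [Fin.tail] using hp i.succ j.succ (Fin.succ_lt_succ_iff.2 hij)
    · have := (hp 0 i.succ.succ (Fin.succ_pos _)).1 h
      simp at this
  · intro f hf g hg hfg
    simp only [inducedPathSeqsFrom, Finset.coe_filter, Finset.mem_univ, true_and,
      Set.mem_ofPred_eq] at hf hg
    rw [← Fin.cons_self_tail f, ← Fin.cons_self_tail g, hfg, hf.2.1, hg.2.1]

theorem card_inducedPathSeqsFrom_le {V : Type*} [Fintype V] (G : SimpleGraph V) (k : ℕ)
    (S : Finset V) (v : V) :
    ((inducedPathSeqsFrom G k S v).card : ℝ) ≤ ((S.card : ℝ) / k) ^ k := by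
  classical
  induction k generalizing S v with
  | zero =>
    rw [pow_zero]
    refine Nat.cast_le_one.2 (Finset.card_le_one.2 ?_)
    intro f hf g hg
    simp only [inducedPathSeqsFrom, Finset.mem_filter] at hf hg
    funext i
    rw [show i = 0 from Fin.fin_one_eq_zero i, hf.2.2.1, hg.2.2.1]
  | succ k ih =>
    have hcard : ((S.filter fun w => ¬ G.Adj v w).card : ℝ) =
        S.card - (S.filter fun w => G.Adj v w).card := by
      rw [← Finset.card_filter_add_card_filter_not (s := S) (fun w => G.Adj v w)]
      push_cast
      ring
    calc ((inducedPathSeqsFrom G (k + 1) S v).card : ℝ)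
        ≤ ∑ w ∈ S with G.Adj v w,
            ((inducedPathSeqsFrom G k {w ∈ S | ¬ G.Adj v w} w).card : ℝ) := by
          have := card_inducedPathSeqsFrom_succ_le G k S v
          exact_mod_cast this
      _ ≤ ∑ w ∈ S with G.Adj v w,
            (((S.filter fun w => ¬ G.Adj v w).card : ℝ) / k) ^ k :=
          Finset.sum_le_sum fun w _ => ih _ w
      _ ≤ _ := by
          rw [Finset.sum_const, nsmul_eq_mul, hcard]
          push_cast
          exact mul_div_pow_le _ _ (Nat.cast_nonneg _)
            (by exact_mod_cast Finset.card_filter_le _ _) k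

open Classical in
theorem card_isInducedPathSeq_le {V : Type*} [Fintype V] (G : SimpleGraph V) (k : ℕ) :
    ((Finset.univ.filter fun f : Fin (k + 1) → V => IsInducedPathSeq G f).card : ℝ) ≤
      Fintype.card V * ((Fintype.card V : ℝ) / k) ^ k := by
  have h : (Finset.univ.filter fun f : Fin (k + 1) → V => IsInducedPathSeq G f) ⊆
      Finset.univ.biUnion fun v => inducedPathSeqsFrom G k Finset.univ v := by
    intro f hf
    simpa [inducedPathSeqsFrom] using hf
  calc ((Finset.univ.filter fun f : Fin (k + 1) → V => IsInducedPathSeq G f).card : ℝ)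
      ≤ ∑ v : V, ((inducedPathSeqsFrom G k Finset.univ v).card : ℝ) := by
        exact_mod_cast (Finset.card_le_card h).trans Finset.card_biUnion_le
    _ ≤ ∑ v : V, ((Fintype.card V : ℝ) / k) ^ k :=
        Finset.sum_le_sum fun v _ => card_inducedPathSeqsFrom_le G k Finset.univ v
    _ = _ := by simp

theorem IsInducedPathSeq.comp_rev {V : Type*} {G : SimpleGraph V} {k : ℕ} {f : Fin k → V}
    (hf : IsInducedPathSeq G f) : IsInducedPathSeq G (f ∘ Fin.rev) := by
  intro i j hij
  have := hf j.rev i.rev (Fin.rev_lt_rev.2 hij)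
  rw [Function.comp, Function.comp, G.adj_comm, this, Fin.val_rev, Fin.val_rev]
  omega

theorem exists_isInducedPathSeq_of_iso {V : Type*} {G : SimpleGraph V} {k : ℕ} {s : Set V}
    (e : G.induce s ≃g SimpleGraph.pathGraph k) :
    ∃ f : Fin k → V, IsInducedPathSeq G f ∧ Function.Injective f ∧ Set.range f = s := by
  refine ⟨fun i => (e.symm i : V), fun i j hij => ?_,
    Subtype.val_injective.comp e.symm.injective, ?_⟩
  · have h : G.Adj (e.symm i) (e.symm j) ↔ (SimpleGraph.pathGraph k).Adj i j :=
      e.symm.map_adj_iff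
    rw [h, SimpleGraph.pathGraph_adj]
    have : (i : ℕ) < j := hij
    omega
  · ext x
    constructor
    · rintro ⟨i, rfl⟩
      exact (e.symm i).2
    · intro hx
      exact ⟨e ⟨x, hx⟩, by simp⟩

open Classical in
theorem two_mul_ncard_inducedPaths_le {V : Type*} [Fintype V] (G : SimpleGraph V) (r : ℕ)
    (hr : 2 ≤ r) :
    2 * Set.ncard {s : Finset V | s.card = r ∧
        Nonempty (G.induce (s : Set V) ≃g SimpleGraph.pathGraph r)} ≤
      (Finset.univ.filter fun f : Fin r → V => IsInducedPathSeq G f).card := by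
  set A := {s : Finset V | s.card = r ∧
    Nonempty (G.induce (s : Set V) ≃g SimpleGraph.pathGraph r)}
  have hA : ∀ s : A, ∃ f : Fin r → V,
      IsInducedPathSeq G f ∧ Function.Injective f ∧ Set.range f = (s : Finset V) :=
    fun s => exists_isInducedPathSeq_of_iso s.2.2.some
  choose F hF hinj hrange using hA
  let Φ : Bool × A → {f : Fin r → V // IsInducedPathSeq G f} := fun p =>
    if p.1 then ⟨F p.2, hF p.2⟩ else ⟨F p.2 ∘ Fin.rev, (hF p.2).comp_rev⟩
  have hΦrange : ∀ p, Set.range (Φ p).1 = (p.2 : Finset V) := by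
    rintro ⟨b, s⟩
    cases b
    · simp [Φ, Fin.rev_surjective.range_comp, hrange]
    · simp [Φ, hrange]
  have hne : ∀ s, F s ≠ F s ∘ Fin.rev := by
    intro s h
    have h0 := hinj s (congrFun h ⟨0, by omega⟩)
    have := congrArg Fin.val h0
    simp only [Fin.val_rev] at this
    omega
  have hΦ : Function.Injective Φ := by
    rintro ⟨b, s⟩ ⟨c, t⟩ h
    obtain rfl : s = t := by
      apply Subtype.ext
      apply Finset.coe_injective
      rw [← hΦrange (b, s), h, hΦrange (c, t)]
    have h' := congrArg Subtype.val h
    cases b <;> cases c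
    · rfl
    · exact absurd h'.symm (hne s)
    · exact absurd h' (hne s)
    · rfl
  have h := Nat.card_le_card_of_injective Φ hΦ
  rw [Nat.card_prod, Nat.card_eq_fintype_card, Fintype.card_bool, Nat.card_coe_set_eq,
    Nat.card_eq_fintype_card, Fintype.card_subtype] at h
  exact h


/-- Pippenger–Golumbic. Let `G` be a simple graph on `n` vertices and
`r ≥ 2`. Then the number of induced subgraphs of `G` isomorphic to the path `P_r` on `r`
vertices is at most `(n/2) · (n/(r-1))^(r-1)`. -/
theorem induced_path_count_le {V : Type*} [Fintype V] [DecidableEq V]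
    (G : SimpleGraph V) (r : ℕ) (hr : 2 ≤ r) :
    (Set.ncard {s : Finset V | s.card = r ∧
        Nonempty (G.induce (s : Set V) ≃g SimpleGraph.pathGraph r)} : ℝ)
      ≤ ((Fintype.card V : ℝ) / 2) * ((Fintype.card V : ℝ) / ((r : ℝ) - 1)) ^ (r - 1) := by
  classical
  obtain ⟨k, rfl⟩ : ∃ k, r = k + 1 := ⟨r - 1, by omega⟩
  have h1 : (2 : ℝ) * (Set.ncard {s : Finset V | s.card = k + 1 ∧
      Nonempty (G.induce (s : Set V) ≃g SimpleGraph.pathGraph (k + 1))} : ℝ) ≤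
      (Finset.univ.filter fun f : Fin (k + 1) → V => IsInducedPathSeq G f).card := by
    exact_mod_cast two_mul_ncard_inducedPaths_le G (k + 1) hr
  have h2 := h1.trans (card_isInducedPathSeq_le G k)
  simp only [Nat.cast_add, Nat.cast_one, add_sub_cancel_right, Nat.add_sub_cancel]
  linarith
end

section
/- Let H = (V, E) be an n-uniform hypergraph with V finite and let r ≥ 1 be an integer. Then H admits a proper r-coloring if and only if there exists a linear order on V with respect to which H contains no ordered r-chain. -/
/-- In a linear order, the vertices `m 0, …, m k` together with the sets `a 0, …, a (k - 1)` of `E`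
form a linked sequence if `m i` and `m (i + 1)` are the least and the greatest element of `a i`. -/
def IsLinked {V : Type*} [LinearOrder V] (E : Finset (Finset V)) (k : ℕ)
    (a : ℕ → Finset V) (m : ℕ → V) : Prop :=
  ∀ i < k, a i ∈ E ∧ IsLeast (a i : Set V) (m i) ∧ IsGreatest (a i : Set V) (m (i + 1))

namespace IsLinked

variable {V : Type*} [LinearOrder V] {E : Finset (Finset V)} {k : ℕ}
  {a : ℕ → Finset V} {m : ℕ → V}

theorem exists_append (h : IsLinked E k a m) {e : Finset V} (he : e ∈ E) {w : V}
    (hu : IsLeast (e : Set V) (m k)) (hw : IsGreatest (e : Set V) w) :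
    ∃ a' m', IsLinked E (k + 1) a' m' ∧ m' (k + 1) = w := by
  refine ⟨fun i => if i < k then a i else e, fun i => if i ≤ k then m i else w, ?_, by simp⟩
  intro i hi
  rcases Nat.lt_succ_iff_lt_or_eq.mp hi with hik | rfl
  · simpa [hik, hik.le, Nat.succ_le_iff] using h i hik
  · simpa using ⟨he, hu, hw⟩

theorem lt_succ (h : IsLinked E k a m) (hE : ∀ e ∈ E, 1 < e.card) {i : ℕ} (hi : i < k) :
    m i < m (i + 1) := by
  obtain ⟨hmem, hmin, hmax⟩ := h i hi
  obtain ⟨x, hx, y, hy, hxy⟩ := Finset.one_lt_card.mp (hE _ hmem)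
  rcases lt_or_gt_of_ne hxy with hlt | hlt
  · exact (hmin.2 hx).trans_lt (hlt.trans_le (hmax.2 hy))
  · exact (hmin.2 hy).trans_lt (hlt.trans_le (hmax.2 hx))

theorem lt_of_lt (h : IsLinked E k a m) (hE : ∀ e ∈ E, 1 < e.card) {i j : ℕ} (hij : i < j)
    (hj : j ≤ k) : m i < m j := by
  induction j, hij using Nat.le_induction with
  | base => exact h.lt_succ hE hj
  | succ j _ ih => exact (ih (by lia)).trans (h.lt_succ hE hj)

theorem le_of_mem (h : IsLinked E k a m) (hE : ∀ e ∈ E, 1 < e.card) {i j : ℕ} (hij : i < j)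
    (hj : j < k) {u v : V} (hu : u ∈ a i) (hv : v ∈ a j) : u ≤ v := by
  have hmid : m (i + 1) ≤ m j := by
    rcases Nat.eq_or_lt_of_le (Nat.succ_le_of_lt hij) with heq | hlt
    · exact (congrArg m heq).le
    · exact (h.lt_of_lt hE hlt hj.le).le
  exact ((h i (hij.trans hj)).2.2.2 hu).trans (hmid.trans ((h j hj).2.1.2 hv))

theorem inter_succ (h : IsLinked E k a m) {i : ℕ} (hi : i + 1 < k) :
    a i ∩ a (i + 1) = {m (i + 1)} := by
  obtain ⟨-, -, hmax⟩ := h i (by lia)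
  obtain ⟨-, hmin, -⟩ := h (i + 1) hi
  ext x
  simp only [Finset.mem_inter, Finset.mem_singleton]
  refine ⟨fun hx => le_antisymm (hmax.2 hx.1) (hmin.2 hx.2), ?_⟩
  rintro rfl
  exact ⟨hmax.1, hmin.1⟩

theorem inter_eq_empty (h : IsLinked E k a m) (hE : ∀ e ∈ E, 1 < e.card) {i j : ℕ}
    (hij : i + 1 < j) (hj : j < k) : a i ∩ a j = ∅ := by
  ext x
  simp only [Finset.mem_inter, Finset.notMem_empty, iff_false, not_and]
  intro hxi hxj
  exact ((((h i (by lia)).2.2.2 hxi).trans_lt (h.lt_of_lt hE hij hj.le)).trans_le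
    ((h j hj).2.1.2 hxj)).false

end IsLinked

/-- If a linear order admits no linked sequence of `r` edges, then there is a proper
`r`-coloring: color each vertex by the length of the longest linked sequence ending at it. -/
theorem exists_coloring_of_not_isLinked {V : Type*} [LinearOrder V] {E : Finset (Finset V)}
    {r : ℕ} (hr : 1 ≤ r) (hE : ∀ e ∈ E, 1 < e.card) (h : ∀ a m, ¬ IsLinked E r a m) :
    ∃ c : V → Fin r, ∀ e ∈ E, ∃ u ∈ e, ∃ v ∈ e, c u ≠ c v := by
  classical
  let P : V → ℕ → Prop := fun v k => ∃ a m, IsLinked E k a m ∧ m k = v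
  let d : V → ℕ := fun v => Nat.findGreatest (P v) (r - 1)
  have hd : ∀ v, d v ≤ r - 1 := fun v => Nat.findGreatest_le _
  refine ⟨fun v => ⟨d v, by have := hd v; lia⟩, fun e he => ?_⟩
  have hne : e.Nonempty := Finset.card_pos.mp (by have := hE e he; lia)
  refine ⟨e.min' hne, e.min'_mem hne, e.max' hne, e.max'_mem hne, fun heq => ?_⟩
  have heq' : d (e.min' hne) = d (e.max' hne) := congrArg Fin.val heq
  have hP : P (e.min' hne) (d (e.min' hne)) :=
    Nat.findGreatest_spec (P := P (e.min' hne)) (Nat.zero_le _)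
      ⟨fun _ => ∅, fun _ => e.min' hne, fun i hi => absurd hi (Nat.not_lt_zero i), rfl⟩
  obtain ⟨a, m, ham, hm⟩ := hP
  obtain ⟨a', m', ham', hm'⟩ := ham.exists_append he (by rw [hm]; exact e.isLeast_min' hne)
    (e.isGreatest_max' hne)
  have hlt : d (e.min' hne) + 1 ≤ r - 1 := by
    by_contra hcon
    have hr' : d (e.min' hne) + 1 = r := by have := hd (e.min' hne); lia
    exact h a' m' (hr' ▸ ham')
  have hle : d (e.min' hne) + 1 ≤ d (e.max' hne) :=
    Nat.le_findGreatest hlt ⟨a', m', ham', hm'⟩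
  lia

/-- If the order refines the order of the colors of a proper `r`-coloring, then there is no
sequence of `r` edges in which each edge lies below the next one. -/
theorem not_ordered_of_coloring {V : Type*} {r : ℕ} (hr : 1 ≤ r) {E : Finset (Finset V)}
    {c : V → Fin r} (hc : ∀ e ∈ E, ∃ u ∈ e, ∃ v ∈ e, c u ≠ c v)
    {le : V → V → Prop} (hle : ∀ u v, le u v → c u ≤ c v) {a : Fin r → Finset V}
    (ha : ∀ i, a i ∈ E) (hord : ∀ i j : Fin r, i < j → ∀ u ∈ a i, ∀ v ∈ a j, le u v) :
    False := by
  have key : ∀ k (hk : k < r), ∃ v ∈ a ⟨k, hk⟩, k + 1 ≤ (c v : ℕ) := by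
    intro k hk
    have hlow : ∀ u ∈ a ⟨k, hk⟩, k ≤ (c u : ℕ) := by
      induction k with
      | zero => simp
      | succ k ih =>
        intro u hu
        obtain ⟨x, hx, y, hy, hxy⟩ := hc _ (ha ⟨k, by lia⟩)
        have hx' := ih (by lia) x hx
        have hy' := ih (by lia) y hy
        have hxu := hle _ _ (hord ⟨k, by lia⟩ ⟨k + 1, hk⟩ (by simp) x hx u hu)
        have hyu := hle _ _ (hord ⟨k, by lia⟩ ⟨k + 1, hk⟩ (by simp) y hy u hu)
        rw [Fin.le_def] at hxu hyu
        have := Fin.val_ne_of_ne hxy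
        lia
    obtain ⟨x, hx, y, hy, hxy⟩ := hc _ (ha ⟨k, hk⟩)
    have hx' := hlow x hx
    have hy' := hlow y hy
    have hxy' := Fin.val_ne_of_ne hxy
    rcases lt_or_gt_of_ne hxy' with hlt | hlt
    · exact ⟨y, hy, by lia⟩
    · exact ⟨x, hx, by lia⟩
  obtain ⟨v, -, hv⟩ := key (r - 1) (by lia)
  have := (c v).isLt
  lia

/-- Pluhár. An `n`-uniform hypergraph `H = (V, E)` on a finite vertex
set admits a proper `r`-coloring if and only if there exists a linear order on `V` with
respect to which `H` contains no ordered `r`-chain. -/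
theorem pluhar_ordered_chains {V : Type*} [Fintype V] [DecidableEq V]
    (n r : ℕ) (hn : 2 ≤ n) (hr : 1 ≤ r)
    (E : Finset (Finset V)) (hE : ∀ e ∈ E, e.card = n) :
    (∃ c : V → Fin r, ∀ e ∈ E, ∃ u ∈ e, ∃ v ∈ e, c u ≠ c v) ↔
    (∃ le : V → V → Prop, IsLinearOrder V le ∧
      ¬ ∃ a : Fin r → Finset V,
        (∀ i, a i ∈ E) ∧
        (∀ i j : Fin r, ((i : ℤ) - (j : ℤ)).natAbs = 1 → (a i ∩ a j).card = 1) ∧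
        (∀ i j : Fin r, 2 ≤ ((i : ℤ) - (j : ℤ)).natAbs → a i ∩ a j = ∅) ∧
        (∀ i j : Fin r, i < j → ∀ u ∈ a i, ∀ v ∈ a j, le u v)) := by
  constructor
  · rintro ⟨c, hc⟩
    let f : V → Fin r ×ₗ Fin (Fintype.card V) := fun v => toLex (c v, Fintype.equivFin V v)
    have hf : Function.Injective f := fun u v huv =>
      (Fintype.equivFin V).injective (congrArg Prod.snd (toLex.injective huv))
    refine ⟨fun u v => f u ≤ f v,
      { refl := fun _ => le_rfl
        trans := fun _ _ _ => le_trans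
        antisymm := fun _ _ h₁ h₂ => hf (le_antisymm h₁ h₂)
        total := fun _ _ => le_total _ _ }, ?_⟩
    rintro ⟨a, ha, -, -, hord⟩
    refine not_ordered_of_coloring hr hc (fun u v huv => ?_) ha hord
    rcases Prod.Lex.le_iff.mp huv with hlt | heq
    · exact hlt.le
    · exact heq.1.le
  · rintro ⟨le, hlin, hno⟩
    let _ : LinearOrder V :=
      { le := le
        le_refl := hlin.refl
        le_trans := hlin.trans
        le_antisymm := hlin.antisymm
        le_total := hlin.total
        toDecidableLE := Classical.decRel _
        toDecidableEq := inferInstance }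
    have hE' : ∀ e ∈ E, 1 < e.card := fun e he => by rw [hE e he]; lia
    refine exists_coloring_of_not_isLinked hr hE' fun a m h => hno ⟨fun i => a i, ?_, ?_, ?_, ?_⟩
    · exact fun i => (h i i.isLt).1
    · intro i j hij
      rcases (by omega : (j : ℕ) = i + 1 ∨ (i : ℕ) = j + 1) with hj | hi
      · have hjr := j.isLt
        rw [hj] at hjr
        beta_reduce
        rw [hj]
        exact Finset.card_eq_one.mpr ⟨_, h.inter_succ hjr⟩
      · have hir := i.isLt
        rw [hi] at hir
        beta_reduce
        rw [hi, Finset.inter_comm]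
        exact Finset.card_eq_one.mpr ⟨_, h.inter_succ hir⟩
    · intro i j hij
      rcases (by omega : (i : ℕ) + 1 < j ∨ (j : ℕ) + 1 < i) with hlt | hlt
      · exact h.inter_eq_empty hE' hlt j.isLt
      · rw [Finset.inter_comm]
        exact h.inter_eq_empty hE' hlt i.isLt
    · exact fun i j hij u hu v hv => h.le_of_mem hE' hij j.isLt hu hv
end

section
/- Let n ≥ 2, and let a, r be integers with 1 ≤ a < r. If H = (V, E) is an n-uniform hypergraph with |E| < a^(n−1) · (r − a) · (n − 1), then H admits a proper r-coloring. -/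
/-- A map is constant on `e` for at most a fraction `a ^ (1 - #e)` of all maps to `Fin a`. -/
theorem card_constant_on_mul_le {V : Type*} [Fintype V] [DecidableEq V] (a : ℕ) (e : Finset V)
    (he : e.Nonempty) :
    Fintype.card {c : V → Fin a // ∀ u ∈ e, ∀ v ∈ e, c u = c v} * a ^ (e.card - 1) ≤
      a ^ Fintype.card V := by
  obtain ⟨w, hw⟩ := he
  let F : {c : V → Fin a // ∀ u ∈ e, ∀ v ∈ e, c u = c v} × (↥(e.erase w) → Fin a) →
      (V → Fin a) := fun p v => if h : v ∈ e.erase w then p.2 ⟨v, h⟩ else p.1.1 v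
  have hF : Function.Injective F := by
    rintro ⟨⟨c, hc⟩, g⟩ ⟨⟨d, hd⟩, g'⟩ h
    have hoff : ∀ v, v ∉ e.erase w → c v = d v := fun v hv => by
      simpa only [F, dif_neg hv] using congrFun h v
    have hcd : c = d := by
      funext v
      by_cases hv : v ∈ e.erase w
      · have hve := Finset.mem_of_mem_erase hv
        rw [hc v hve w hw, hd v hve w hw, hoff w (Finset.notMem_erase w e)]
      · exact hoff v hv
    have hg : g = g' := by
      funext v
      simpa only [F, dif_pos v.2] using congrFun h v.1
    subst hcd hg
    rfl
  simpa only [Fintype.card_prod, Fintype.card_fun, Fintype.card_fin, Fintype.card_coe,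
    Finset.card_erase_of_mem hw] using Fintype.card_le_of_injective F hF

/-- Some `a`-coloring has fewer than `K` monochromatic edges if `#E < a ^ (n - 1) * K`. -/
theorem exists_coloring_card_monochromatic_lt {V : Type*} [Fintype V] [DecidableEq V]
    (n a K : ℕ) (hn : 1 ≤ n) (ha : 1 ≤ a) (E : Finset (Finset V)) (hE : ∀ e ∈ E, e.card = n)
    (hcount : E.card < a ^ (n - 1) * K) :
    ∃ c : V → Fin a, (E.filter fun e => ∀ u ∈ e, ∀ v ∈ e, c u = c v).card < K := by
  by_contra! hK
  have hsum : a ^ Fintype.card V * K ≤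
      ∑ e ∈ E, Fintype.card {c : V → Fin a // ∀ u ∈ e, ∀ v ∈ e, c u = c v} := by
    calc a ^ Fintype.card V * K = ∑ _c : V → Fin a, K := by simp
      _ ≤ ∑ c : V → Fin a, (E.filter fun e => ∀ u ∈ e, ∀ v ∈ e, c u = c v).card :=
        Finset.sum_le_sum fun c _ => hK c
      _ = _ := by
        simp only [Fintype.card_subtype, Finset.card_filter]
        exact Finset.sum_comm
  have hmul : a ^ Fintype.card V * (a ^ (n - 1) * K) ≤ a ^ Fintype.card V * E.card := by
    calc a ^ Fintype.card V * (a ^ (n - 1) * K) = a ^ Fintype.card V * K * a ^ (n - 1) := by ring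
      _ ≤ ∑ e ∈ E, Fintype.card {c : V → Fin a // ∀ u ∈ e, ∀ v ∈ e, c u = c v} *
          a ^ (n - 1) := by
        rw [← Finset.sum_mul]
        exact Nat.mul_le_mul_right _ hsum
      _ ≤ ∑ _e ∈ E, a ^ Fintype.card V := Finset.sum_le_sum fun e he => by
        have hne : e.Nonempty := Finset.card_pos.mp (by rw [hE e he]; omega)
        simpa only [hE e he] using card_constant_on_mul_le a e hne
      _ = a ^ Fintype.card V * E.card := by simp [mul_comm]
  exact absurd (Nat.le_of_mul_le_mul_left hmul (by positivity)) (by omega)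

/-- A set of fewer than `k * m` vertices can be split into `k` classes of size at most `m`. -/
theorem exists_map_fin_card_fiber_le {V : Type*} (S : Finset V) (k m : ℕ) (hm : 0 < m)
    (hS : S.card < k * m) :
    ∃ g : S → Fin k, ∀ T : Finset V, ∀ hT : T ⊆ S,
      (∀ u, ∀ hu : u ∈ T, ∀ v, ∀ hv : v ∈ T, g ⟨u, hT hu⟩ = g ⟨v, hT hv⟩) → T.card ≤ m := by
  let f := S.equivFin
  refine ⟨fun v => ⟨f v / m, (Nat.div_lt_iff_lt_mul hm).mpr ((f v).2.trans hS)⟩, ?_⟩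
  intro T hT hg
  have hinj : Function.Injective
      (fun v : T => (⟨f ⟨v, hT v.2⟩ % m, Nat.mod_lt _ hm⟩ : Fin m)) := by
    intro u v huv
    have hdiv := congrArg Fin.val (hg u u.2 v v.2)
    have hmod := congrArg Fin.val huv
    have hf : f ⟨u, hT u.2⟩ = f ⟨v, hT v.2⟩ := Fin.ext <| by
      simp only at hdiv hmod
      rw [← Nat.div_add_mod (f ⟨u, hT u.2⟩ : ℕ) m, hdiv, hmod, Nat.div_add_mod]
    exact Subtype.ext (congrArg (fun x : S => (x : V)) (f.injective hf))
  simpa using Fintype.card_le_of_injective _ hinj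

/-- Alon's recoloring bound. Let `n ≥ 2` and `1 ≤ a < r`. If
`H = (V, E)` is an `n`-uniform hypergraph with `|E| < a^(n−1) · (r − a) · (n − 1)`,
then `H` admits a proper `r`-coloring. -/
theorem alon_recoloring {V : Type*} [Fintype V] (n a r : ℕ)
    (hn : 2 ≤ n) (ha : 1 ≤ a) (har : a < r)
    (E : Finset (Finset V)) (hE : ∀ e ∈ E, e.card = n)
    (hcount : E.card < a ^ (n - 1) * (r - a) * (n - 1)) :
    ∃ c : V → Fin r, ∀ e ∈ E, ∃ u ∈ e, ∃ v ∈ e, c u ≠ c v := by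
  classical
  obtain ⟨c, hc⟩ := exists_coloring_card_monochromatic_lt n a ((r - a) * (n - 1)) (by omega) ha
    E hE (by rwa [← mul_assoc])
  have hne : ∀ e ∈ E, e.Nonempty := fun e he => Finset.card_pos.mp (by rw [hE e he]; omega)
  set M := E.filter fun e => ∀ u ∈ e, ∀ v ∈ e, c u = c v
  choose p hp using fun e : M => hne e (Finset.mem_filter.mp e.2).1
  let S := Finset.univ.image p
  have hS : S.card < (r - a) * (n - 1) := by
    refine lt_of_le_of_lt Finset.card_image_le ?_
    simpa using hc
  obtain ⟨g, hg⟩ := exists_map_fin_card_fiber_le S (r - a) (n - 1) (by omega) hS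
  let d : V → Fin r := fun v =>
    if h : v ∈ S then ⟨a + g ⟨v, h⟩, by have := (g ⟨v, h⟩).2; omega⟩
    else ⟨c v, (c v).2.trans har⟩
  have hd_mem : ∀ v (h : v ∈ S), (d v : ℕ) = a + g ⟨v, h⟩ := fun v h => by simp [d, h]
  have hd_notMem : ∀ v, v ∉ S → (d v : ℕ) = c v := fun v h => by simp [d, h]
  refine ⟨d, fun e he => ?_⟩
  by_contra! hmono
  by_cases hsub : e ⊆ S
  · have hcard := hg e hsub fun u hu v hv => Fin.ext <| by
      have h := congrArg Fin.val (hmono u hu v hv)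
      rw [hd_mem u (hsub hu), hd_mem v (hsub hv)] at h
      omega
    rw [hE e he] at hcard
    omega
  · obtain ⟨w, hwe, hwS⟩ := Finset.not_subset.mp hsub
    have hdisj : ∀ v ∈ e, v ∉ S := fun v hv hvS => by
      have h := congrArg Fin.val (hmono v hv w hwe)
      rw [hd_mem v hvS, hd_notMem w hwS] at h
      have := (c w).2
      omega
    have heM : e ∈ M := Finset.mem_filter.mpr ⟨he, fun u hu v hv => Fin.ext <| by
      rw [← hd_notMem u (hdisj u hu), ← hd_notMem v (hdisj v hv), hmono u hu v hv]⟩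
    exact hdisj _ (hp ⟨e, heM⟩) (Finset.mem_image_of_mem p (Finset.mem_univ _))
end

section
/- For all integers n ≥ 2 and r ≥ 2, m(n, r) ≥ (n − 1) · ⌈r/n⌉ · ⌊(n − 1)r/n⌋^(n−1). -/
/-- `m n r` is the minimal number of edges in an `n`-uniform hypergraph that admits
no proper `r`-coloring. -/
noncomputable def minNonColorable (n r : ℕ) : ℕ :=
  sInf {N : ℕ | ∃ E : Finset (Finset ℕ), (∀ e ∈ E, e.card = n) ∧ E.card = N ∧
    ¬ ∃ c : ℕ → Fin r, ∀ e ∈ E, ∃ u ∈ e, ∃ v ∈ e, c u ≠ c v}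

open Finset in
/-- The number of `a`-colorings of `α` that are constant on the nonempty set `e` is at most
`a ^ (card α - (#e - 1))`. -/
theorem card_constantOn_mul_pow_le {α : Type*} [Fintype α] [DecidableEq α] {a : ℕ}
    {e : Finset α} (he : e.Nonempty) :
    #{f : α → Fin a | ∀ u ∈ e, ∀ v ∈ e, f u = f v} * a ^ (#e - 1) ≤ a ^ Fintype.card α := by
  obtain ⟨x, hx⟩ := he
  have hcard : a ^ (#e - 1) = Fintype.card ({u // u ∈ e.erase x} → Fin a) := by
    rw [Fintype.card_fun, Fintype.card_fin, Fintype.card_coe, card_erase_of_mem hx]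
  have hcard' : a ^ Fintype.card α = Fintype.card (α → Fin a) := by simp
  rw [hcard, hcard', ← card_univ, ← card_univ, ← card_product]
  refine card_le_card_of_injOn
    (fun p u ↦ if h : u ∈ e.erase x then p.2 ⟨u, h⟩ else p.1 u) (by simp) ?_
  rintro ⟨f, g⟩ hf ⟨f', g'⟩ hf' h
  simp only [coe_product, coe_filter, mem_univ, true_and, coe_univ, Set.mem_prod,
    Set.mem_ofPred_eq, Set.mem_univ, and_true] at hf hf'
  have off : ∀ u ∉ e.erase x, f u = f' u := fun u hu ↦ by simpa [hu] using congrFun h u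
  have hfx : f x = f' x := off x (by simp)
  refine Prod.ext (funext fun u ↦ ?_) (funext fun ⟨u, hu⟩ ↦ ?_)
  · by_cases hu : u ∈ e
    · exact (hf u hu x hx).trans (hfx.trans (hf' x hx u hu))
    · exact off u fun h ↦ hu (mem_of_mem_erase h)
  · have := congrFun h u
    simp only [hu, dite_true] at this
    exact this

open Finset in
/-- First moment bound on a finite vertex set: some `a`-coloring leaves fewer than `K` edges
monochromatic. -/
theorem exists_coloring_card_constantOn_lt {α ι : Type*} [Fintype α] [DecidableEq α] {a n K : ℕ}
    (ha : 0 < a) (hn : 0 < n) (E : Finset ι) (s : ι → Finset α) (hE : ∀ i ∈ E, #(s i) = n)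
    (hK : #E < K * a ^ (n - 1)) :
    ∃ f : α → Fin a, #{i ∈ E | ∀ u ∈ s i, ∀ v ∈ s i, f u = f v} < K := by
  by_contra! hcon
  have hcount : ∑ i ∈ E, #{f : α → Fin a | ∀ u ∈ s i, ∀ v ∈ s i, f u = f v}
      = ∑ f : α → Fin a, #{i ∈ E | ∀ u ∈ s i, ∀ v ∈ s i, f u = f v} := by
    simp only [card_filter]
    exact sum_comm
  have hlower : a ^ Fintype.card α * K
      ≤ ∑ f : α → Fin a, #{i ∈ E | ∀ u ∈ s i, ∀ v ∈ s i, f u = f v} := by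
    simpa using card_nsmul_le_sum univ _ K fun f _ ↦ hcon f
  have hupper : (∑ i ∈ E, #{f : α → Fin a | ∀ u ∈ s i, ∀ v ∈ s i, f u = f v}) * a ^ (n - 1)
      ≤ #E * a ^ Fintype.card α := by
    rw [sum_mul, ← smul_eq_mul]
    refine sum_le_card_nsmul _ _ _ fun i hi ↦ ?_
    rw [← hE i hi]
    exact card_constantOn_mul_pow_le (card_pos.1 (by rw [hE i hi]; exact hn))
  have hlt := Nat.mul_lt_mul_of_pos_right hK (Nat.pow_pos (n := Fintype.card α) ha)
  have hle := (Nat.mul_le_mul_right (a ^ (n - 1)) (hlower.trans_eq hcount.symm)).trans hupper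
  refine (hlt.trans_le' hle).ne ?_
  ring

open Finset in
/-- A finite set of size at most `k * b` splits into `b` parts of size at most `k`. -/
theorem exists_coloring_card_fiber_le {α : Type*} [LinearOrder α] (S : Finset α) {k b : ℕ}
    (hb : 0 < b) (hS : #S ≤ k * b) :
    ∃ g : α → Fin b, ∀ j, #{u ∈ S | g u = j} ≤ k := by
  have : NeZero b := ⟨hb.ne'⟩
  let idx : α → ℕ := fun u ↦ #{v ∈ S | v < u}
  have idx_lt : ∀ u ∈ S, idx u < #S := fun u hu ↦
    card_lt_card ⟨filter_subset _ _, fun h ↦ by simpa using h hu⟩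
  have idx_mono : ∀ u ∈ S, ∀ v, u < v → idx u < idx v := fun u hu v huv ↦
    card_lt_card ⟨fun w hw ↦ by
      simp only [mem_filter] at hw ⊢
      exact ⟨hw.1, hw.2.trans huv⟩, fun h ↦ by
      have := h (mem_filter.2 ⟨hu, huv⟩)
      simp at this⟩
  have idx_inj : ∀ u ∈ S, ∀ v ∈ S, idx u = idx v → u = v := fun u hu v hv h ↦ by
    rcases lt_trichotomy u v with huv | huv | huv
    · exact absurd h (idx_mono u hu v huv).ne
    · exact huv
    · exact absurd h (idx_mono v hv u huv).ne'
  refine ⟨fun u ↦ Fin.ofNat b (idx u / k), fun j ↦ ?_⟩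
  rcases Nat.eq_zero_or_pos k with rfl | hk
  · have : S = ∅ := by simpa using hS
    simp [this]
  have hdiv : ∀ u ∈ S, Fin.ofNat b (idx u / k) = j → idx u / k = j := fun u hu h ↦ by
    rw [← h, Fin.val_ofNat, Nat.mod_eq_of_lt]
    exact Nat.div_lt_of_lt_mul ((idx_lt u hu).trans_le hS)
  calc _ ≤ #(range k) := card_le_card_of_injOn (fun u ↦ idx u % k)
          (fun u _ ↦ by simpa using Nat.mod_lt _ hk) ?_
    _ = k := card_range k
  intro u hu v hv h
  simp only [coe_filter, Set.mem_ofPred_eq] at hu hv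
  refine idx_inj u hu.1 v hv.1 ?_
  rw [← Nat.div_add_mod (idx u) k, ← Nat.div_add_mod (idx v) k,
    hdiv u hu.1 hu.2, hdiv v hv.1 hv.2]
  exact congrArg _ h

open Finset in
/-- If an `a`-coloring leaves at most `(n - 1) * b` edges monochromatic, then recoloring one
vertex from each of them with `b` new colors gives a proper coloring. -/
theorem exists_proper_coloring_of_card_constantOn_le {α : Type*} [LinearOrder α] {a b n : ℕ}
    (hb : 0 < b) (hn : 0 < n) (E : Finset (Finset α)) (hE : ∀ e ∈ E, #e = n) (c : α → Fin a)
    (hc : #{e ∈ E | ∀ u ∈ e, ∀ v ∈ e, c u = c v} ≤ (n - 1) * b) :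
    ∃ c' : α → Fin (a + b), ∀ e ∈ E, ∃ u ∈ e, ∃ v ∈ e, c' u ≠ c' v := by
  have hne : ∀ e ∈ E, ∃ u, u ∈ e := fun e he ↦ card_pos.1 (by rw [hE e he]; exact hn)
  rcases isEmpty_or_nonempty α with hα | hα
  · exact ⟨isEmptyElim, fun e he ↦ (hne e he).elim fun u _ ↦ isEmptyElim u⟩
  choose! x hx using hne
  set M := {e ∈ E | ∀ u ∈ e, ∀ v ∈ e, c u = c v}
  obtain ⟨g, hg⟩ := exists_coloring_card_fiber_le (M.image x) hb (card_image_le.trans hc)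
  refine ⟨fun u ↦ if u ∈ M.image x then Fin.natAdd a (g u) else Fin.castAdd b (c u),
    fun e he ↦ ?_⟩
  by_contra! hmono
  have hdisj : ∀ (i : Fin a) (j : Fin b), Fin.natAdd a j ≠ Fin.castAdd b i := fun i j h ↦ by
    have := congrArg Fin.val h
    simp only [Fin.val_natAdd, Fin.val_castAdd] at this
    omega
  by_cases hmem : x e ∈ M.image x
  · have hsub : e ⊆ {u ∈ M.image x | g u = g (x e)} := fun u hu ↦ by
      have h := hmono u hu (x e) (hx e he)
      rw [if_pos hmem] at h
      split_ifs at h with hu'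
      · exact mem_filter.2 ⟨hu', Fin.natAdd_injective _ _ h⟩
      · exact absurd h.symm (hdisj _ _)
    have := (card_le_card hsub).trans (hg _)
    rw [hE e he] at this
    omega
  · have hconst : ∀ u ∈ e, c u = c (x e) := fun u hu ↦ by
      have h := hmono u hu (x e) (hx e he)
      rw [if_neg hmem] at h
      split_ifs at h with hu'
      · exact absurd h (hdisj _ _)
      · exact Fin.castAdd_injective _ _ h
    exact hmem (mem_image_of_mem x (mem_filter.2
      ⟨he, fun u hu v hv ↦ (hconst u hu).trans (hconst v hv).symm⟩))

open Finset in
/-- An `n`-uniform hypergraph with fewer than `(n - 1) * b * a ^ (n - 1)` edges is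
`(a + b)`-colorable. -/
theorem exists_proper_coloring_of_card_lt {α : Type*} [LinearOrder α] {a b n : ℕ} (ha : 0 < a)
    (hn : 0 < n) (E : Finset (Finset α)) (hE : ∀ e ∈ E, #e = n)
    (hcard : #E < (n - 1) * b * a ^ (n - 1)) :
    ∃ c : α → Fin (a + b), ∀ e ∈ E, ∃ u ∈ e, ∃ v ∈ e, c u ≠ c v := by
  have : NeZero a := ⟨ha.ne'⟩
  have hb : 0 < b := Nat.pos_of_ne_zero (by rintro rfl; simp at hcard)
  let V := E.biUnion id
  have hV : ∀ e ∈ E, ∀ u ∈ e, u ∈ V := fun e he u hu ↦ mem_biUnion.2 ⟨e, he, hu⟩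
  obtain ⟨f, hf⟩ := exists_coloring_card_constantOn_lt ha hn E (fun e ↦ e.subtype (· ∈ V))
    (fun e he ↦ by rw [card_subtype, filter_true_of_mem (hV e he), hE e he]) hcard
  refine exists_proper_coloring_of_card_constantOn_le hb hn E hE
    (fun u ↦ if h : u ∈ V then f ⟨u, h⟩ else 0) (hf.le.trans' (card_le_card ?_))
  intro e he
  simp only [mem_filter, mem_subtype] at he ⊢
  refine ⟨he.1, fun u hu v hv ↦ ?_⟩
  simpa using he.2 u hu v hv

open Finset in
/-- The complete `n`-uniform hypergraph on `(n - 1) * r + 1` vertices is not `r`-colorable. -/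
theorem not_exists_proper_coloring_powersetCard (n r : ℕ) :
    ¬ ∃ c : ℕ → Fin r, ∀ e ∈ powersetCard n (range (r * (n - 1) + 1)),
      ∃ u ∈ e, ∃ v ∈ e, c u ≠ c v := by
  rintro ⟨c, hc⟩
  obtain ⟨j, -, hj⟩ := exists_lt_card_fiber_of_mul_lt_card_of_maps_to
    (s := range (r * (n - 1) + 1)) (t := univ) (f := c) (n := n - 1) (by simp) (by simp)
  obtain ⟨e, he, hcard⟩ := exists_subset_card_eq (Nat.le_of_pred_lt hj)
  obtain ⟨u, hu, v, hv, huv⟩ := hc e (mem_powersetCard.2 ⟨he.trans (filter_subset _ _), hcard⟩)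
  exact huv ((mem_filter.1 (he hu)).2.trans (mem_filter.1 (he hv)).2.symm)

theorem Nat.sub_one_mul_div_add_ceilDiv (n r : ℕ) (hn : 0 < n) :
    (n - 1) * r / n + (r + n - 1) / n = r := by
  obtain ⟨k, rfl⟩ := Nat.exists_eq_add_of_lt hn
  simp only [Nat.zero_add, Nat.add_sub_cancel, ← Nat.add_assoc]
  have h₁ := Nat.div_add_mod (k * r) (k + 1)
  have h₂ := Nat.mod_lt (k * r) (Nat.add_one_pos k)
  have h₃ := Nat.div_add_mod (r + k) (k + 1)
  have h₄ := Nat.mod_lt (r + k) (Nat.add_one_pos k)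
  generalize k * r / (k + 1) = p, k * r % (k + 1) = s at *
  generalize (r + k) / (k + 1) = q, (r + k) % (k + 1) = t at *
  apply le_antisymm
  · by_contra! h
    nlinarith
  · by_contra! h
    nlinarith

/-- For all integers `n ≥ 2` and `r ≥ 2`,
`m(n, r) ≥ (n − 1) · ⌈r/n⌉ · ⌊(n − 1)r/n⌋^(n−1)`. -/
theorem alon_lower_bound (n r : ℕ) (hn : 2 ≤ n) (hr : 2 ≤ r) :
    (n - 1) * ((r + n - 1) / n) * (((n - 1) * r) / n) ^ (n - 1)
      ≤ minNonColorable n r := by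
  have hn₀ : 0 < n := by omega
  refine le_csInf ⟨_, _, fun e he ↦ (Finset.mem_powersetCard.1 he).2, rfl,
    not_exists_proper_coloring_powersetCard n r⟩ ?_
  rintro _ ⟨E, hE, rfl, hcol⟩
  by_contra! hlt
  refine hcol ?_
  have ha : 0 < (n - 1) * r / n := by
    refine Nat.div_pos ?_ hn₀
    obtain ⟨k, rfl⟩ := Nat.exists_eq_add_of_le hn
    rw [show 2 + k - 1 = k + 1 by omega]
    nlinarith
  have h := exists_proper_coloring_of_card_lt ha hn₀ E hE hlt
  rwa [Nat.sub_one_mul_div_add_ceilDiv n r hn₀] at h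
end

section
/- Let n ≥ 2 and r ≥ 2 be integers and let H = (V, E) be an n-uniform hypergraph with V finite. If 2 · (|E|^r / r!) · ((n−1)!)^2 · ((n−2)!)^(r−2) / ((n−1)r + 1)! < 1, then H admits a proper r-coloring. -/
open Finset in
lemma card_mul_card_le_of_act {X H : Type*} [Fintype X] [Group H] [Fintype H]
    (act : X → H → X) (act_one : ∀ x, act x 1 = x)
    (act_mul : ∀ x g h, act (act x g) h = act x (g * h)) (S : Finset X) (K : ℕ)
    (hS : ∀ s ∈ S, ∃ T : Finset H, T.card ≤ K ∧ ∀ h, act s h ∈ S → h ∈ T) :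
    S.card * Fintype.card H ≤ Fintype.card X * K := by
  classical
  have key := sum_card_bipartiteAbove_eq_sum_card_bipartiteBelow (s := (univ : Finset X))
    (t := (univ : Finset H)) (fun x h => act x h ∈ S)
  have hr : ∀ h ∈ (univ : Finset H),
      #(bipartiteBelow (fun x h => act x h ∈ S) univ h) = S.card := by
    intro h _
    refine card_nbij' (fun x => act x h) (fun x => act x h⁻¹) ?_ ?_ ?_ ?_
    · intro x hx
      simpa [bipartiteBelow] using hx
    · intro x hx
      simpa [bipartiteBelow, act_mul, act_one] using hx
    · intro x _
      simp [act_mul, act_one]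
    · intro x _
      simp [act_mul, act_one]
  have hl : ∀ x ∈ (univ : Finset X),
      #(bipartiteAbove (fun x h => act x h ∈ S) univ x) ≤ K := by
    intro x _
    by_cases hx : ∃ h, act x h ∈ S
    · obtain ⟨h₀, hh₀⟩ := hx
      obtain ⟨T, hT, hmem⟩ := hS _ hh₀
      refine le_trans (card_le_card_of_injOn (fun h => h₀⁻¹ * h) ?_ ?_) hT
      · intro h hh
        refine hmem _ ?_
        simpa [bipartiteAbove, act_mul] using hh
      · intro a _ b _ hab
        simpa using hab
    · push Not at hx
      simp [bipartiteAbove, hx]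
  rw [sum_congr rfl hr] at key
  have := sum_le_sum hl
  rw [key] at this
  simpa [mul_comm] using this

open Finset in
lemma comp_perm_eq_of_monotone {α β : Type*} [Fintype α] [LinearOrder β]
    (p : α → β) (L : α → ℕ) (τ : Equiv.Perm α)
    (h₁ : ∀ x y, L x < L y → p x < p y) (h₂ : ∀ x y, L x < L y → p (τ x) < p (τ y)) :
    L ∘ τ = L := by
  classical
  have key : ∀ a x, L (τ x) < a ↔ L x < a := by
    intro a
    set D : Finset α := univ.filter fun x => L x < a with hD
    have hcard : (D.map τ.toEmbedding).card = D.card := card_map _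
    have heq : D.map τ.toEmbedding = D := by
      by_cases hsub : D ⊆ D.map τ.toEmbedding
      · exact (eq_of_subset_of_card_le hsub hcard.le).symm
      · refine eq_of_subset_of_card_le ?_ hcard.ge
        obtain ⟨x, hx, hx'⟩ := not_subset.mp hsub
        intro y hy
        obtain ⟨w, hw, rfl⟩ := mem_map.mp hy
        by_contra hyD
        obtain ⟨z, rfl⟩ := τ.surjective x
        have hz : ¬ L z < a := fun hz => hx' (mem_map.mpr ⟨z, by simp [hD, hz], rfl⟩)
        simp only [hD, mem_filter, mem_univ, true_and, Equiv.coe_toEmbedding] at hx hw hyD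
        exact lt_asymm (h₁ (τ z) (τ w) (by omega)) (h₂ w z (by omega))
    intro x
    have : τ x ∈ D.map τ.toEmbedding ↔ x ∈ D := by simp
    rw [heq] at this
    simpa [hD] using this
  funext x
  have h1 := key (L x) x
  have h2 := key (L x + 1) x
  simp only [Function.comp]
  omega

/-- The edges `f 0, f 1, …` form a chain under the order `σ`: the `σ`-last vertex of each edge is
the `σ`-first vertex of the next one. -/
def IsOrderedChain {V β : Type*} [LE β] {r : ℕ} (σ : V → β) (f : Fin r → Finset V) : Prop :=
  ∀ i j : Fin r, (i : ℕ) + 1 = j →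
    ∃ v, v ∈ f i ∧ v ∈ f j ∧ (∀ u ∈ f i, σ u ≤ σ v) ∧ ∀ u ∈ f j, σ v ≤ σ u

namespace IsOrderedChain

variable {V β : Type*} [LinearOrder β] {r : ℕ} {σ : V → β} {f : Fin r → Finset V}

lemma le_of_lt (h : IsOrderedChain σ f) {i j : Fin r} (hij : i < j) {x y : V}
    (hx : x ∈ f i) (hy : y ∈ f j) : σ x ≤ σ y := by
  obtain ⟨j, hj⟩ := j
  induction j generalizing y with
  | zero => exact absurd hij (by simp [Fin.lt_def])
  | succ j ih =>
    obtain ⟨v, hv, -, hle, hge⟩ := h ⟨j, by omega⟩ ⟨j + 1, hj⟩ rfl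
    refine le_trans ?_ (hge y hy)
    rcases Nat.lt_succ_iff_lt_or_eq.mp (Fin.lt_def.mp hij) with hlt | heq
    · exact ih (by omega) (Fin.lt_def.mpr hlt) hv
    · have hi : i = ⟨j, by omega⟩ := Fin.ext heq
      rw [hi] at hx
      exact hle x hx

lemma eq_of_mem (h : IsOrderedChain σ f) (hσ : Function.Injective σ) {i j : Fin r}
    (hij : (i : ℕ) + 1 = j) {x y : V} (hx : x ∈ f i) (hx' : x ∈ f j) (hy : y ∈ f i)
    (hy' : y ∈ f j) : x = y := by
  have hlt : i < j := Fin.lt_def.mpr (by omega)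
  exact hσ (le_antisymm (h.le_of_lt hlt hx hy') (h.le_of_lt hlt hy hx'))

lemma index_le_succ (h : IsOrderedChain σ f) (hσ : Function.Injective σ)
    (hcard : ∀ i, 2 ≤ (f i).card) {i j : Fin r} {x : V} (hi : x ∈ f i) (hj : x ∈ f j) :
    (j : ℕ) ≤ i + 1 := by
  by_contra! hlt
  let k : Fin r := ⟨i + 1, by omega⟩
  have hk : (f k).card ≤ 1 := by
    refine Finset.card_le_one.mpr fun a ha b hb => ?_
    have hx : ∀ w ∈ f k, w = x := fun w hw => hσ (le_antisymm
      (h.le_of_lt (Fin.lt_def.mpr hlt) hw hj)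
      (h.le_of_lt (Fin.lt_def.mpr (Nat.lt_succ_self _)) hi hw))
    rw [hx a ha, hx b hb]
  have := hcard k
  omega

/-- Two links of one edge are distinct. -/
lemma link_ne_link (h : IsOrderedChain σ f) (hσ : Function.Injective σ)
    (hcard : ∀ i, 2 ≤ (f i).card) {i j k : Fin r} (hij : (i : ℕ) + 1 = j)
    (hjk : (j : ℕ) + 1 = k) {x y : V} (hx : x ∈ f i) (hy : y ∈ f k) : x ≠ y := by
  rintro rfl
  have := h.index_le_succ hσ hcard hx hy
  omega

lemma card_biUnion_ge [DecidableEq V] (h : IsOrderedChain σ f) (hσ : Function.Injective σ)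
    {n : ℕ} (hn : 2 ≤ n) (hcard : ∀ i, (f i).card = n) (hr : 0 < r) :
    (n - 1) * r + 1 ≤ (Finset.univ.biUnion f).card := by
  have hcard' : ∀ i, 2 ≤ (f i).card := fun i => (hcard i).symm ▸ hn
  have key : ∀ k, k + 1 ≤ r → (n - 1) * (k + 1) + 1 ≤
      ((Finset.univ.filter fun i : Fin r => (i : ℕ) < k + 1).biUnion f).card := by
    intro k
    induction k with
    | zero =>
      intro hk
      calc (n - 1) * (0 + 1) + 1 = (f ⟨0, hr⟩).card := by rw [hcard]; omega
        _ ≤ _ := Finset.card_le_card (Finset.subset_biUnion_of_mem f (by simp))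
    | succ k ih =>
      intro hk
      obtain ⟨v, hv, hv', -, -⟩ := h ⟨k, by omega⟩ ⟨k + 1, by omega⟩ rfl
      have hdisj : Disjoint
          ((Finset.univ.filter fun i : Fin r => (i : ℕ) < k + 1).biUnion f)
          ((f ⟨k + 1, by omega⟩).erase v) := by
        refine Finset.disjoint_left.mpr fun x hx hx' => ?_
        obtain ⟨i, hi, hxi⟩ := Finset.mem_biUnion.mp hx
        obtain ⟨hne, hxk⟩ := Finset.mem_erase.mp hx'
        have h1 := h.index_le_succ hσ hcard' hxi hxk
        have h2 : (i : ℕ) < k + 1 := by simpa using hi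
        have hik : i = ⟨k, by omega⟩ := Fin.ext (by simp only at h1 ⊢; omega)
        rw [hik] at hxi
        exact hne (h.eq_of_mem hσ rfl hxi hxk hv hv')
      have hsub : ((Finset.univ.filter fun i : Fin r => (i : ℕ) < k + 1).biUnion f) ∪
          ((f ⟨k + 1, by omega⟩).erase v) ⊆
          (Finset.univ.filter fun i : Fin r => (i : ℕ) < k + 1 + 1).biUnion f := by
        refine Finset.union_subset ?_ ?_
        · refine Finset.biUnion_subset_biUnion_of_subset_left f fun i => ?_
          simp only [Finset.mem_filter, Finset.mem_univ, true_and]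
          omega
        · exact (Finset.erase_subset _ _).trans
            (Finset.subset_biUnion_of_mem f (by simp))
      have := Finset.card_le_card hsub
      rw [Finset.card_union_of_disjoint hdisj, Finset.card_erase_of_mem hv', hcard] at this
      have ih' := ih (by omega)
      rw [mul_add (n - 1) (k + 1) 1]
      omega
  obtain ⟨k, rfl⟩ : ∃ k, r = k + 1 := ⟨r - 1, by omega⟩
  exact (key k le_rfl).trans
    (Finset.card_le_card (Finset.biUnion_subset_biUnion_of_subset_left f (Finset.filter_subset _ _)))

end IsOrderedChain

lemma perm_fin_eq_one_or_revPerm {r : ℕ} (π : Equiv.Perm (Fin r))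
    (h : ∀ i j : Fin r, (i : ℕ) + 1 = j →
      ((π i : ℕ) ≤ π j + 1 ∧ (π j : ℕ) ≤ π i + 1)) : π = 1 ∨ π = Fin.revPerm := by
  have hne : ∀ i j : Fin r, (i : ℕ) ≠ j → (π i : ℕ) ≠ π j := by
    intro i j hij heq
    exact hij (congrArg Fin.val (π.injective (Fin.ext heq)))
  rcases Nat.lt_or_ge r 2 with hr | hr
  · left
    ext i
    have := (π i).isLt
    have := i.isLt
    simp only [Equiv.Perm.coe_one, id]
    omega
  have h01 := h ⟨0, by omega⟩ ⟨1, by omega⟩ rfl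
  have hn01 := hne ⟨0, by omega⟩ ⟨1, by omega⟩ (by simp)
  rcases Nat.lt_or_ge (π ⟨0, by omega⟩ : ℕ) (π ⟨1, by omega⟩) with hlt | hge
  · left
    have key : ∀ k (hk : k + 1 < r), (π ⟨k, by omega⟩ : ℕ) = π ⟨0, by omega⟩ + k ∧
        (π ⟨k + 1, hk⟩ : ℕ) = π ⟨0, by omega⟩ + k + 1 := by
      intro k
      induction k with
      | zero => intro _; simp only [zero_add] at *; omega
      | succ k ih =>
        intro hk
        have := ih (by omega)
        have h1 := h ⟨k + 1, by omega⟩ ⟨k + 1 + 1, hk⟩ rfl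
        have h2 := hne ⟨k + 1, by omega⟩ ⟨k + 1 + 1, hk⟩ (by simp)
        have h3 := hne ⟨k, by omega⟩ ⟨k + 1 + 1, hk⟩ (by simp only; omega)
        omega
    have hlast := (key (r - 2) (by omega)).2
    have hb := (π ⟨r - 2 + 1, by omega⟩).isLt
    ext i
    simp only [Equiv.Perm.coe_one, id]
    rcases Nat.lt_or_ge ((i : ℕ) + 1) r with hi | hi
    · have := (key i hi).1
      simp only [Fin.eta] at this
      omega
    · have hlast' : i = ⟨r - 2 + 1, by omega⟩ := Fin.ext (by simp only; omega)
      rw [hlast']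
      simp only
      omega
  · right
    have key : ∀ k (hk : k + 1 < r), (π ⟨k, by omega⟩ : ℕ) + k = π ⟨0, by omega⟩ ∧
        (π ⟨k + 1, hk⟩ : ℕ) + k + 1 = π ⟨0, by omega⟩ := by
      intro k
      induction k with
      | zero => intro _; simp only [zero_add] at *; omega
      | succ k ih =>
        intro hk
        have := ih (by omega)
        have h1 := h ⟨k + 1, by omega⟩ ⟨k + 1 + 1, hk⟩ rfl
        have h2 := hne ⟨k + 1, by omega⟩ ⟨k + 1 + 1, hk⟩ (by simp)
        have h3 := hne ⟨k, by omega⟩ ⟨k + 1 + 1, hk⟩ (by simp only; omega)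
        omega
    have hlast := (key (r - 2) (by omega)).2
    have hb := (π ⟨0, by omega⟩).isLt
    ext i
    simp only [Fin.revPerm_apply, Fin.val_rev]
    rcases Nat.lt_or_ge ((i : ℕ) + 1) r with hi | hi
    · have := (key i hi).1
      simp only [Fin.eta] at this
      omega
    · have hlast' : i = ⟨r - 2 + 1, by omega⟩ := Fin.ext (by simp only; omega)
      rw [hlast']
      simp only
      omega

lemma card_chains_mul_factorial_le {V β : Type*} [LinearOrder β] {r n : ℕ} (hn : 2 ≤ n)
    (E : Finset (Finset V)) (hE : ∀ e ∈ E, e.card = n) (S : Finset (Fin r → E))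
    (hS : ∀ f ∈ S, ∃ σ : V → β, Function.Injective σ ∧
      IsOrderedChain σ fun i => (f i : Finset V)) :
    S.card * r.factorial ≤ E.card ^ r * 2 := by
  classical
  have key := card_mul_card_le_of_act (X := Fin r → E) (H := Equiv.Perm (Fin r))
    (fun f π => f ∘ π) (fun _ => rfl) (fun _ _ _ => rfl) S 2 ?_
  · simpa [Fintype.card_perm] using key
  intro f hf
  refine ⟨{1, Fin.revPerm}, Finset.card_le_two, fun π hπ => ?_⟩
  simp only [Finset.mem_insert, Finset.mem_singleton]
  obtain ⟨σ, hσ, hc⟩ := hS f hf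
  obtain ⟨σ', hσ', hc'⟩ := hS _ hπ
  have hcard : ∀ i, 2 ≤ (f i : Finset V).card := fun i => (hE _ (f i).2).symm ▸ hn
  refine perm_fin_eq_one_or_revPerm π fun i j hij => ?_
  obtain ⟨v, hv, hv', -, -⟩ := hc' i j hij
  exact ⟨hc.index_le_succ hσ hcard hv' hv, hc.index_le_succ hσ hcard hv hv'⟩

/-- `ChainEnd E σ k v` says that some ordered chain of `k` edges of `E` ends at `v`. -/
def ChainEnd {V β : Type*} [LE β] (E : Finset (Finset V)) (σ : V → β) : ℕ → V → Prop
  | 0, _ => True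
  | k + 1, v => ∃ e ∈ E, ∃ u ∈ e, ChainEnd E σ k u ∧ v ∈ e ∧ (∀ w ∈ e, σ u ≤ σ w) ∧
      ∀ w ∈ e, σ w ≤ σ v

lemma ChainEnd.exists_chain {V β : Type*} [LE β] {E : Finset (Finset V)} {σ : V → β}
    {k : ℕ} {v : V} (h : ChainEnd E σ k v) :
    ∃ f : Fin k → E, IsOrderedChain σ (fun i => (f i : Finset V)) ∧
      ∀ i : Fin k, (i : ℕ) + 1 = k → v ∈ (f i : Finset V) ∧ ∀ u ∈ (f i : Finset V), σ u ≤ σ v := by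
  induction k generalizing v with
  | zero => exact ⟨fun i => i.elim0, fun i => i.elim0, fun i => i.elim0⟩
  | succ k ih =>
    obtain ⟨e, he, u, hu, hk, hv, hmin, hmax⟩ := h
    obtain ⟨f, hf, hlast⟩ := ih hk
    refine ⟨Fin.snoc f ⟨e, he⟩, ?_, ?_⟩
    · intro i j hij
      induction i using Fin.lastCases with
      | last => have := j.isLt; simp at hij; omega
      | cast i =>
        induction j using Fin.lastCases with
        | last =>
          obtain ⟨h1, h2⟩ := hlast i (by simpa using hij)
          simp only [Fin.snoc_castSucc, Fin.snoc_last]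
          exact ⟨u, h1, hu, h2, hmin⟩
        | cast j =>
          simp only [Fin.snoc_castSucc]
          exact hf i j (by simpa using hij)
    · intro i hi
      obtain rfl : i = Fin.last k := Fin.ext (by simpa using hi)
      simp only [Fin.snoc_last]
      exact ⟨hv, hmax⟩

lemma exists_coloring_of_no_chain {V β : Type*} [LinearOrder β] {r : ℕ} (hr : 0 < r)
    (E : Finset (Finset V)) (hE : ∀ e ∈ E, e.Nonempty) (σ : V → β)
    (hno : ∀ f : Fin r → E, ¬ IsOrderedChain σ fun i => (f i : Finset V)) :
    ∃ c : V → Fin r, ∀ e ∈ E, ∃ u ∈ e, ∃ v ∈ e, c u ≠ c v := by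
  classical
  refine ⟨fun v => ⟨Nat.findGreatest (fun k => ChainEnd E σ k v) (r - 1),
    lt_of_le_of_lt (Nat.findGreatest_le _) (by omega)⟩, fun e he => ?_⟩
  obtain ⟨u, hu, hmin⟩ := e.exists_min_image σ (hE e he)
  obtain ⟨v, hv, hmax⟩ := e.exists_max_image σ (hE e he)
  refine ⟨u, hu, v, hv, fun heq => ?_⟩
  replace heq := congrArg Fin.val heq
  simp only at heq
  set k := Nat.findGreatest (fun k => ChainEnd E σ k u) (r - 1) with hk
  have hku : ChainEnd E σ k u :=
    Nat.findGreatest_spec (P := fun k => ChainEnd E σ k u) (Nat.zero_le _) trivial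
  have hkv : ChainEnd E σ (k + 1) v := ⟨e, he, u, hu, hku, hv, hmin, hmax⟩
  have hkr : k ≤ r - 1 := Nat.findGreatest_le _
  rcases Nat.lt_or_ge k (r - 1) with hlt | hge
  · have := Nat.le_findGreatest (P := fun k => ChainEnd E σ k v) (n := r - 1) (by omega) hkv
    omega
  · have hrk : k + 1 = r := by omega
    rw [hrk] at hkv
    obtain ⟨f, hf, -⟩ := hkv.exists_chain
    exact hno f hf

/-- The number of vertices in the `j`-th block of an ordered chain of `r` edges of size `n`: even
blocks consist of the vertices lying in exactly one edge, odd blocks of the common vertex of two edges. -/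
def chainBlockCard (n r j : ℕ) : ℕ :=
  if j = 0 ∨ j = 2 * r - 2 then n - 1 else if j % 2 = 1 then 1 else n - 2

lemma prod_factorial_chainBlockCard (n r : ℕ) (hr : 2 ≤ r) :
    ∏ j : Fin (2 * r - 1), (chainBlockCard n r j).factorial =
      (n - 1).factorial ^ 2 * (n - 2).factorial ^ (r - 2) := by
  obtain ⟨s, rfl⟩ : ∃ s, r = s + 2 := ⟨r - 2, by omega⟩
  have hinner : ∀ t, ∏ j ∈ Finset.range (2 * t + 1),
      (if (j + 1) % 2 = 1 then 1 else n - 2).factorial = (n - 2).factorial ^ t := by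
    intro t
    induction t with
    | zero => simp
    | succ t ih =>
      rw [show 2 * (t + 1) + 1 = 2 * t + 1 + 1 + 1 by ring, Finset.prod_range_succ,
        Finset.prod_range_succ, ih, if_neg (by omega), if_pos (by omega)]
      simp [pow_succ]
  rw [Fin.prod_univ_eq_prod_range (fun j => (chainBlockCard n (s + 2) j).factorial),
    show 2 * (s + 2) - 1 = 2 * s + 1 + 1 + 1 by omega, Finset.prod_range_succ,
    Finset.prod_range_succ']
  have hmid : ∀ j ∈ Finset.range (2 * s + 1), (chainBlockCard n (s + 2) (j + 1)).factorial =
      (if (j + 1) % 2 = 1 then 1 else n - 2).factorial := by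
    intro j hj
    rw [Finset.mem_range] at hj
    rw [chainBlockCard, if_neg (by omega)]
  rw [Finset.prod_congr rfl hmid, hinner, chainBlockCard, if_pos (Or.inl rfl), chainBlockCard,
    if_pos (Or.inr (by omega)), Nat.add_sub_cancel]
  ring

namespace IsOrderedChain

variable {V β : Type*} [LinearOrder β] {r : ℕ} {σ : V → β} {f : Fin r → Finset V}

lemma card_block_le [DecidableEq V] (h : IsOrderedChain σ f) (hσ : Function.Injective σ)
    {n : ℕ} (hn : 2 ≤ n) (hr : 2 ≤ r) (hcard : ∀ i, (f i).card = n) (j : ℕ) (B : Finset V)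
    (hB : ∀ x ∈ B, ∃ a b : Fin r, (a : ℕ) + b = j ∧ x ∈ f a ∧ x ∈ f b ∧
      ∀ k, x ∈ f k → a ≤ k ∧ k ≤ b) : B.card ≤ chainBlockCard n r j := by
  have hcard' : ∀ i, 2 ≤ (f i).card := fun i => (hcard i).symm ▸ hn
  rcases B.eq_empty_or_nonempty with rfl | ⟨x₀, hx₀⟩
  · simp
  have hjr : j ≤ 2 * r - 2 := by
    obtain ⟨a, b, hab, -⟩ := hB x₀ hx₀
    omega
  unfold chainBlockCard
  rcases Nat.even_or_odd' j with ⟨i, hi | hi⟩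
  · have hir : i < r := by omega
    have hmem : ∀ x ∈ B, x ∈ f ⟨i, hir⟩ ∧ ∀ k, x ∈ f k → k = ⟨i, hir⟩ := by
      intro x hx
      obtain ⟨a, b, hab, ha, hb, hk⟩ := hB x hx
      have h1 := h.index_le_succ hσ hcard' ha hb
      have h2 := Fin.le_def.mp (hk a ha).2
      have ha' : a = ⟨i, hir⟩ := Fin.ext (by simp only; omega)
      have hb' : b = ⟨i, hir⟩ := Fin.ext (by simp only; omega)
      subst hb'
      rw [ha'] at hk
      exact ⟨hb, fun k hxk => le_antisymm (hk k hxk).2 (hk k hxk).1⟩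
    have hdel : ∀ v k, k ≠ ⟨i, hir⟩ → v ∈ f k → ∀ x ∈ B, x ≠ v := by
      rintro v k hne hv x hx rfl
      exact hne ((hmem x hx).2 k hv)
    have hone : ∀ v k, k ≠ ⟨i, hir⟩ → v ∈ f k → v ∈ f ⟨i, hir⟩ → B.card ≤ n - 1 := by
      intro v k hne hv hv'
      rw [← hcard ⟨i, hir⟩, ← Finset.card_erase_of_mem hv']
      exact Finset.card_le_card fun x hx =>
        Finset.mem_erase.mpr ⟨hdel v k hne hv x hx, (hmem x hx).1⟩
    split_ifs with h1 h2
    · rcases h1 with h1 | h1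
      · obtain ⟨v, hv, hv', -, -⟩ := h ⟨i, hir⟩ ⟨i + 1, by omega⟩ rfl
        exact hone v _ (by simp) hv' hv
      · obtain ⟨v, hv, hv', -, -⟩ := h ⟨i - 1, by omega⟩ ⟨i, hir⟩ (by simp only; omega)
        exact hone v _ (by simp only [ne_eq, Fin.mk.injEq]; omega) hv hv'
    · omega
    · obtain ⟨v, hv, hv', -, -⟩ := h ⟨i - 1, by omega⟩ ⟨i, hir⟩ (by simp only; omega)
      obtain ⟨w, hw, hw', -, -⟩ := h ⟨i, hir⟩ ⟨i + 1, by omega⟩ rfl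
      have hvw : v ≠ w :=
        h.link_ne_link hσ hcard' (j := ⟨i, hir⟩) (by simp only; omega) rfl hv hw'
      have hsub : B ⊆ ((f ⟨i, hir⟩).erase v).erase w := fun x hx =>
        Finset.mem_erase.mpr ⟨hdel w _ (by simp) hw' x hx, Finset.mem_erase.mpr
          ⟨hdel v _ (by simp only [ne_eq, Fin.mk.injEq]; omega) hv x hx, (hmem x hx).1⟩⟩
      have := Finset.card_le_card hsub
      rw [Finset.card_erase_of_mem (Finset.mem_erase.mpr ⟨hvw.symm, hw⟩),
        Finset.card_erase_of_mem hv', hcard] at this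
      omega
  · rw [if_neg (by omega), if_pos (by omega)]
    refine Finset.card_le_one.mpr fun x hx y hy => ?_
    have hmem : ∀ x ∈ B, x ∈ f ⟨i, by omega⟩ ∧ x ∈ f ⟨i + 1, by omega⟩ := by
      intro x hx
      obtain ⟨a, b, hab, ha, hb, hk⟩ := hB x hx
      have h1 := h.index_le_succ hσ hcard' ha hb
      have h2 := Fin.le_def.mp (hk a ha).2
      have ha' : a = ⟨i, by omega⟩ := Fin.ext (by simp only; omega)
      have hb' : b = ⟨i + 1, by omega⟩ := Fin.ext (by simp only; omega)
      rw [ha'] at ha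
      rw [hb'] at hb
      exact ⟨ha, hb⟩
    exact h.eq_of_mem hσ rfl (hmem x hx).1 (hmem x hx).2 (hmem y hy).1 (hmem y hy).2

end IsOrderedChain

open Finset in
lemma card_orderings_mul_factorial_le {V β : Type*} [Fintype V] [LinearOrder β] {p : V → β}
    (hp : Function.Injective p) {n r : ℕ} (hn : 2 ≤ n) (hr : 2 ≤ r) (f : Fin r → Finset V)
    (hcard : ∀ i, (f i).card = n) (S : Finset (Equiv.Perm V))
    (hS : ∀ σ ∈ S, IsOrderedChain (p ∘ σ) f) :
    S.card * ((n - 1) * r + 1).factorial ≤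
      (Fintype.card V).factorial * ((n - 1).factorial ^ 2 * (n - 2).factorial ^ (r - 2)) := by
  classical
  rcases S.eq_empty_or_nonempty with rfl | ⟨σ₀, hσ₀⟩
  · simp
  have hinj : ∀ σ : Equiv.Perm V, Function.Injective (p ∘ σ) := fun σ => hp.comp σ.injective
  have hM := (hS σ₀ hσ₀).card_biUnion_ge (hinj σ₀) hn hcard (by omega)
  set M := univ.biUnion f with hMdef
  have hidx : ∀ x : {x // x ∈ M}, ∃ a b : Fin r, (x : V) ∈ f a ∧ (x : V) ∈ f b ∧
      ∀ k, (x : V) ∈ f k → a ≤ k ∧ k ≤ b := by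
    intro x
    have hne : (univ.filter fun i => (x : V) ∈ f i).Nonempty := by
      obtain ⟨i, -, hi⟩ := mem_biUnion.mp x.2
      exact ⟨i, by simp [hi]⟩
    obtain ⟨a, ha, ha'⟩ := exists_min_image _ id hne
    obtain ⟨b, hb, hb'⟩ := exists_max_image _ id hne
    simp only [mem_filter, mem_univ, true_and, id] at ha ha' hb hb'
    exact ⟨a, b, ha, hb, fun k hk => ⟨ha' k hk, hb' k hk⟩⟩
  choose lo hi hlo hhi hbd using hidx
  let L : {x // x ∈ M} → Fin (2 * r - 1) := fun x => ⟨lo x + hi x, by omega⟩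
  have hL : ∀ σ ∈ S, ∀ x y, (L x : ℕ) < L y → p (σ x) < p (σ y) := by
    intro σ hσ x y hxy
    have hle : p (σ x) ≤ p (σ y) := by
      have : lo x < lo y ∨ hi x < hi y := by
        simp only [L] at hxy
        simp only [Fin.lt_def]
        omega
      rcases this with hlt | hlt
      · exact (hS σ hσ).le_of_lt hlt (hlo x) (hlo y)
      · exact (hS σ hσ).le_of_lt hlt (hhi x) (hhi y)
    refine lt_of_le_of_ne hle fun heq => ?_
    obtain rfl : x = y := Subtype.ext (hinj σ heq)
    exact lt_irrefl _ hxy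
  have key := card_mul_card_le_of_act (X := Equiv.Perm V) (H := Equiv.Perm {x // x ∈ M})
    (fun σ τ => σ * Equiv.Perm.ofSubtype τ) (fun _ => by simp)
    (fun _ _ _ => by simp [mul_assoc]) S
    ((n - 1).factorial ^ 2 * (n - 2).factorial ^ (r - 2)) ?_
  · rw [Fintype.card_perm, Fintype.card_perm, Fintype.card_coe] at key
    exact (Nat.mul_le_mul_left _ (Nat.factorial_le hM)).trans key
  intro σ hσ
  refine ⟨univ.filter fun τ => L ∘ τ = L, ?_, fun τ hτ => ?_⟩
  · rw [← Fintype.card_subtype, DomMulAct.stabilizer_card, ← prod_factorial_chainBlockCard n r hr]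
    refine prod_le_prod' fun j _ => Nat.factorial_le ?_
    rw [Fintype.card_subtype, ← card_map (Function.Embedding.subtype _)]
    refine (hS σ hσ).card_block_le (hinj σ) hn hr hcard j _ fun x hx => ?_
    obtain ⟨y, hy, rfl⟩ := mem_map.mp hx
    refine ⟨lo y, hi y, ?_, hlo y, hhi y, hbd y⟩
    exact congrArg Fin.val (mem_filter.mp hy).2
  · have h := comp_perm_eq_of_monotone (fun x : {x // x ∈ M} => p (σ x))
      (fun x => (L x : ℕ)) τ (hL σ hσ) (fun x y hxy => by simpa using hL _ hτ x y hxy)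
    refine mem_filter.mpr ⟨mem_univ _, funext fun x => Fin.ext ?_⟩
    exact congrFun h x

/-- Pluhár's chain bound on colorability. If
`2 · (|E|^r / r!) · ((n−1)!)² · ((n−2)!)^(r−2) / ((n−1)r + 1)! < 1`, then the
`n`-uniform hypergraph `H = (V, E)` admits a proper `r`-coloring. -/
theorem pluhar_colorability {V : Type*} [Fintype V] (n r : ℕ) (hn : 2 ≤ n) (hr : 2 ≤ r)
    (E : Finset (Finset V)) (hE : ∀ e ∈ E, e.card = n)
    (h : 2 * ((E.card : ℝ) ^ r / (Nat.factorial r : ℝ))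
        * ((Nat.factorial (n - 1) : ℝ)) ^ 2 * ((Nat.factorial (n - 2) : ℝ)) ^ (r - 2)
        / (Nat.factorial ((n - 1) * r + 1) : ℝ) < 1) :
    ∃ c : V → Fin r, ∀ e ∈ E, ∃ u ∈ e, ∃ v ∈ e, c u ≠ c v := by
  classical
  by_contra hcol
  have hp : Function.Injective (Fintype.equivFin V) := (Fintype.equivFin V).injective
  generalize (Fintype.equivFin V : V → Fin (Fintype.card V)) = p at hp
  have hchain : ∀ σ : Equiv.Perm V, ∃ f : Fin r → E,
      IsOrderedChain (p ∘ σ) fun i => (f i : Finset V) := by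
    intro σ
    by_contra! hno
    exact hcol (exists_coloring_of_no_chain (by omega) E
      (fun e he => Finset.card_pos.mp (by rw [hE e he]; omega)) _ hno)
  set K := (n - 1).factorial ^ 2 * (n - 2).factorial ^ (r - 2) with hK
  set m := ((n - 1) * r + 1).factorial with hm
  let S : (Fin r → E) → Finset (Equiv.Perm V) := fun f =>
    Finset.univ.filter fun σ => IsOrderedChain (p ∘ σ) fun i => (f i : Finset V)
  let T : Finset (Fin r → E) := Finset.univ.filter fun f => (S f).Nonempty
  have hT : T.card * r.factorial ≤ E.card ^ r * 2 := by
    refine card_chains_mul_factorial_le (β := Fin (Fintype.card V)) hn E hE T fun f hf => ?_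
    obtain ⟨σ, hσ⟩ := (Finset.mem_filter.mp hf).2
    exact ⟨p ∘ σ, hp.comp σ.injective, (Finset.mem_filter.mp hσ).2⟩
  have hcover : (Fintype.card V).factorial ≤ ∑ f ∈ T, (S f).card := by
    rw [← Fintype.card_perm, ← Finset.card_univ]
    refine le_trans (Finset.card_le_card fun σ _ => ?_) Finset.card_biUnion_le
    obtain ⟨f, hf⟩ := hchain σ
    have hσ : σ ∈ S f := Finset.mem_filter.mpr ⟨Finset.mem_univ _, hf⟩
    exact Finset.mem_biUnion.mpr ⟨f, Finset.mem_filter.mpr ⟨Finset.mem_univ _, σ, hσ⟩, hσ⟩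
  have hsum : (∑ f ∈ T, (S f).card) * m ≤ T.card * ((Fintype.card V).factorial * K) := by
    rw [Finset.sum_mul]
    exact Finset.sum_le_card_nsmul _ _ _ fun f _ => card_orderings_mul_factorial_le hp hn hr _
      (fun i => hE _ (f i).2) _ fun σ hσ => (Finset.mem_filter.mp hσ).2
  have hmK : m ≤ T.card * K := by
    refine Nat.le_of_mul_le_mul_left ?_ (Nat.factorial_pos (Fintype.card V))
    calc _ ≤ _ := (Nat.mul_le_mul_right m hcover).trans hsum
      _ = _ := by ring
  have hfinal : m * r.factorial ≤ E.card ^ r * 2 * K := by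
    calc m * r.factorial ≤ T.card * K * r.factorial := Nat.mul_le_mul_right _ hmK
      _ = T.card * r.factorial * K := by ring
      _ ≤ _ := Nat.mul_le_mul_right _ hT
  have hm0 : (0 : ℝ) < m := by exact_mod_cast Nat.factorial_pos _
  have hr0 : (0 : ℝ) < r.factorial := by exact_mod_cast Nat.factorial_pos _
  have hfinal' : (m : ℝ) * r.factorial ≤ (E.card : ℝ) ^ r * 2 *
      (((n - 1).factorial : ℝ) ^ 2 * ((n - 2).factorial : ℝ) ^ (r - 2)) := by
    exact_mod_cast hfinal
  rw [div_lt_one hm0, mul_div_assoc', div_mul_eq_mul_div, div_mul_eq_mul_div, div_lt_iff₀ hr0] at h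
  linarith
end

section
/- Let n ≥ 2 and r ≥ 2 be integers and let a_1, …, a_r be an r-chain in an n-uniform hypergraph, so that the union W = a_1 ∪ ⋯ ∪ a_r has exactly (n−1)r + 1 vertices. Then the number of linear orders on W with respect to which the chain (a_1, …, a_r) is ordered equals ((n−1)!)^2 · ((n−2)!)^(r−2); equivalently, a uniformly random linear order on W makes the chain ordered with probability ((n−1)!)^2 · ((n−2)!)^(r−2) / ((n−1)r + 1)!. -/
theorem ncard_linearOrder_refining {α ι : Type*} [Fintype α] [DecidableEq α] [LinearOrder ι]
    [Fintype ι] (f : α → ι) :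
    Set.ncard {le : α → α → Prop | IsLinearOrder α le ∧ ∀ u v, f u < f v → le u v}
      = ∏ k, (Fintype.card {u // f u = k}).factorial := by
  classical
  rw [← DomMulAct.stabilizer_card f]
  obtain ⟨e₀, h₀⟩ : ∃ e : α ≃ Fin (Fintype.card α), Monotone (f ∘ e.symm) :=
    ⟨((Tuple.sort (f ∘ (Fintype.equivFin α).symm)).trans (Fintype.equivFin α).symm).symm,
      Tuple.monotone_sort (f ∘ (Fintype.equivFin α).symm)⟩
  rw [← Nat.card_eq_fintype_card, ← Nat.card_coe_set_eq]
  symm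
  refine Nat.card_congr (Equiv.ofBijective
    (fun g => ⟨fun u v => e₀ (g.1 u) ≤ e₀ (g.1 v), ?_, ?_⟩) ⟨?_, ?_⟩)
  · exact
      { refl := fun _ => le_refl _
        trans := fun _ _ _ => le_trans
        antisymm := fun _ _ h h' => g.1.injective (e₀.injective (le_antisymm h h'))
        total := fun _ _ => le_total _ _ }
  · intro u v huv
    by_contra! h
    have := h₀ h.le
    have h1 := congrFun g.2 u
    have h2 := congrFun g.2 v
    simp only [Function.comp_apply, Equiv.symm_apply_apply] at this h1 h2
    rw [h1, h2] at this
    exact absurd huv this.not_gt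
  · intro g h hgh
    have hle : ∀ u v, e₀ (g.1 u) ≤ e₀ (g.1 v) ↔ e₀ (h.1 u) ≤ e₀ (h.1 v) := fun u v =>
      iff_of_eq (congrFun (congrFun (congrArg Subtype.val hgh) u) v)
    let φ : Fin (Fintype.card α) ≃o Fin (Fintype.card α) :=
      { toEquiv := (g.1.trans e₀).symm.trans (h.1.trans e₀)
        map_rel_iff' := by
          intro x y
          simp [← hle] }
    have hφ : φ = OrderIso.refl _ := Subsingleton.elim _ _
    refine Subtype.ext (Equiv.ext fun u => ?_)
    have := congrArg (fun ψ : Fin (Fintype.card α) ≃o Fin (Fintype.card α) => ψ (e₀ (g.1 u))) hφ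
    simp only [φ] at this
    exact (e₀.injective (by simpa using this)).symm
  · rintro ⟨le, hlin, href⟩
    let : LinearOrder α :=
      { le := le
        le_refl := hlin.refl
        le_trans := hlin.trans
        le_antisymm := hlin.antisymm
        le_total := hlin.total
        toDecidableLE := Classical.decRel _ }
    let e : α ≃o Fin (Fintype.card α) := (Fintype.orderIsoFinOfCardEq α rfl).symm
    have he : Monotone (f ∘ e.symm) := by
      intro i j hij
      by_contra! h
      have h1 : e.symm j ≤ e.symm i := href _ _ h
      have : i = j := le_antisymm hij (e.symm.le_iff_le.1 h1)
      exact absurd h (by simp [this])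
    refine ⟨⟨e.toEquiv.trans e₀.symm, ?_⟩, ?_⟩
    · have h := Tuple.unique_monotone (f := f ∘ e₀.symm) (σ := 1)
        (τ := e.symm.toEquiv.trans e₀)
        (by simpa using h₀) (by simpa [Function.comp_def] using he)
      funext u
      simpa using congrFun h (e u)
    · refine Subtype.ext ?_
      funext u v
      simp only [Equiv.trans_apply, Equiv.apply_symm_apply]
      exact propext e.le_iff_le

/-- The position function of a chain: the vertices lying only in `A i` are sent to `2 * i`, and
those in both `A i` and `A (i + 1)` to `2 * i + 1`. -/
theorem exists_chain_position {V : Type*} (A : ℕ → Finset V)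
    (hA : ∀ i j, i + 2 ≤ j → Disjoint (A i) (A j)) :
    ∃ f : V → ℕ, ∀ u, (∃ i, u ∈ A i) → ∀ j, u ∈ A j ↔ 2 * j ≤ f u + 1 ∧ f u ≤ 2 * j + 1 := by
  classical
  suffices h : ∀ u, ∃ k, (∃ i, u ∈ A i) → ∀ j, u ∈ A j ↔ 2 * j ≤ k + 1 ∧ k ≤ 2 * j + 1 by
    choose f hf using h
    exact ⟨f, hf⟩
  intro u
  by_cases hu : ∃ i, u ∈ A i
  swap
  · exact ⟨0, fun h => absurd h hu⟩
  have hi := Nat.find_spec hu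
  have hmin : ∀ j, u ∈ A j → Nat.find hu ≤ j := fun j hj => Nat.find_min' hu hj
  generalize Nat.find hu = i at hi hmin
  have hmax : ∀ j, u ∈ A j → j ≤ i + 1 := fun j hj => by
    by_contra! h
    exact Finset.disjoint_left.1 (hA i j h) hi hj
  by_cases hi' : u ∈ A (i + 1)
  · refine ⟨2 * i + 1, fun _ j => ⟨fun hj => ?_, fun hj => ?_⟩⟩
    · have := hmin j hj
      have := hmax j hj
      omega
    · obtain rfl | rfl : j = i ∨ j = i + 1 := by omega
      exacts [hi, hi']
  · refine ⟨2 * i, fun _ j => ⟨fun hj => ?_, fun hj => ?_⟩⟩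
    · have := hmin j hj
      have := hmax j hj
      have : j ≠ i + 1 := by rintro rfl; exact hi' hj
      omega
    · obtain rfl : j = i := by omega
      exact hi

/-- The product of the factorials of the position class sizes of a chain. -/
theorem prod_factorial_chain_position (F : ℕ → ℕ) (n s : ℕ)
    (hodd : ∀ i ≤ s, F (2 * i + 1) = 1) (hlast : F (2 * s + 3) = 0)
    (hzero : F 0 + F 1 = n)
    (heven : ∀ i ≤ s, F (2 * i + 1) + F (2 * i + 2) + F (2 * i + 3) = n) :
    ∏ k ∈ Finset.range (2 * (s + 2)), (F k).factorial
      = (n - 1).factorial ^ 2 * (n - 2).factorial ^ s := by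
  have key : ∀ m ≤ s, ∏ k ∈ Finset.range (2 * m + 2), (F k).factorial
      = (n - 1).factorial * (n - 2).factorial ^ m := by
    intro m
    induction m with
    | zero =>
      intro _
      have h0 : F 1 = 1 := hodd 0 (Nat.zero_le _)
      have : F 0 = n - 1 := by omega
      simp [Finset.prod_range_succ, this, h0]
    | succ m ih =>
      intro hm
      have h1 := hodd m (by omega)
      have h2 := hodd (m + 1) hm
      have h3 := heven m (by omega)
      rw [show 2 * (m + 1) + 1 = 2 * m + 3 by ring] at h2
      have : F (2 * m + 2) = n - 2 := by omega
      rw [show 2 * (m + 1) + 2 = 2 * m + 2 + 1 + 1 by ring, Finset.prod_range_succ,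
        Finset.prod_range_succ, ih (by omega), this, h2, pow_succ]
      simp [mul_assoc]
  have h1 := hodd s le_rfl
  have h3 := heven s le_rfl
  have : F (2 * s + 2) = n - 1 := by omega
  rw [show 2 * (s + 2) = 2 * s + 2 + 1 + 1 by ring, Finset.prod_range_succ,
    Finset.prod_range_succ, key s le_rfl, this, hlast]
  simp only [Nat.factorial_zero]
  ring

/-- The linear orders on the vertices of a chain that make it ordered, counted for chains indexed
by `ℕ` with `s + 2` edges. -/
theorem ncard_linearOrder_ordered_chain {V : Type*} [DecidableEq V] (n s : ℕ)
    (A : ℕ → Finset V) (hcard : ∀ i < s + 2, (A i).card = n)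
    (hempty : ∀ i, s + 2 ≤ i → A i = ∅)
    (hone : ∀ i ≤ s, (A i ∩ A (i + 1)).card = 1)
    (hA : ∀ i j, i + 2 ≤ j → Disjoint (A i) (A j))
    (W : Finset V) (hW : ∀ u, u ∈ W ↔ ∃ i, u ∈ A i) :
    Set.ncard {le : {x // x ∈ W} → {x // x ∈ W} → Prop |
        IsLinearOrder {x // x ∈ W} le ∧
        ∀ u v : {x // x ∈ W},
          (∃ i j : ℕ, i < j ∧ (u : V) ∈ A i ∧ (v : V) ∈ A j) → le u v}
      = (n - 1).factorial ^ 2 * (n - 2).factorial ^ s := by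
  obtain ⟨f, hf⟩ := exists_chain_position A hA
  replace hf : ∀ u ∈ W, ∀ j, u ∈ A j ↔ 2 * j ≤ f u + 1 ∧ f u ≤ 2 * j + 1 :=
    fun u hu => hf u ((hW u).1 hu)
  have hAeq : ∀ j, A j = W.filter (fun u => 2 * j ≤ f u + 1 ∧ f u ≤ 2 * j + 1) := by
    intro j
    ext u
    rw [Finset.mem_filter]
    exact ⟨fun h => ⟨(hW u).2 ⟨j, h⟩, (hf u ((hW u).2 ⟨j, h⟩) j).1 h⟩,
      fun h => (hf u h.1 j).2 h.2⟩
  have hinter : ∀ i, A i ∩ A (i + 1) = W.filter (fun u => f u = 2 * i + 1) := by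
    intro i
    rw [hAeq, hAeq, ← Finset.filter_and]
    refine Finset.filter_congr fun u _ => ?_
    omega
  have hlt : ∀ u ∈ W, f u < 2 * (s + 2) := by
    intro u hu
    by_contra! h
    have hm := (hf u hu (f u / 2)).2 (by omega)
    rw [hempty _ (by omega)] at hm
    simp at hm
  set F : ℕ → ℕ := fun k => (W.filter (fun u => f u = k)).card with hF
  have hsum : ∀ i, (A (i + 1)).card = F (2 * i + 1) + F (2 * i + 2) + F (2 * i + 3) := by
    intro i
    rw [hAeq, hF, ← Finset.card_union_of_disjoint, ← Finset.card_union_of_disjoint]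
    · congr 1
      ext u
      simp only [Finset.mem_union, Finset.mem_filter]
      by_cases hu : u ∈ W <;> simp only [hu, true_and, false_and, or_self]
      omega
    · rw [Finset.disjoint_left]
      intro u
      simp only [Finset.mem_union, Finset.mem_filter]
      omega
    · rw [Finset.disjoint_left]
      intro u
      simp only [Finset.mem_filter]
      omega
  have hzero : (A 0).card = F 0 + F 1 := by
    rw [hAeq, hF, ← Finset.card_union_of_disjoint]
    · congr 1
      ext u
      simp only [Finset.mem_union, Finset.mem_filter]
      by_cases hu : u ∈ W <;> simp only [hu, true_and, false_and, or_self]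
      omega
    · rw [Finset.disjoint_left]
      intro u
      simp only [Finset.mem_filter]
      omega
  have hodd : ∀ i ≤ s, F (2 * i + 1) = 1 := fun i hi => by
    have := hone i hi
    rwa [hinter] at this
  have hlast : F (2 * s + 3) = 0 := by
    have := hinter (s + 1)
    rw [hempty (s + 1 + 1) (by omega), Finset.inter_empty] at this
    rw [hF]
    exact (congrArg Finset.card this).symm
  rw [← prod_factorial_chain_position F n s hodd hlast (by rw [← hzero, hcard 0 (by omega)])
    (fun i hi => by rw [← hsum, hcard _ (by omega)]), Finset.prod_range]
  let p : {x // x ∈ W} → Fin (2 * (s + 2)) := fun u => ⟨f u, hlt u u.2⟩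
  have hcount := ncard_linearOrder_refining p
  have hset : {le : {x // x ∈ W} → {x // x ∈ W} → Prop |
        IsLinearOrder {x // x ∈ W} le ∧
        ∀ u v : {x // x ∈ W},
          (∃ i j : ℕ, i < j ∧ (u : V) ∈ A i ∧ (v : V) ∈ A j) → le u v}
      = {le | IsLinearOrder {x // x ∈ W} le ∧ ∀ u v, p u < p v → le u v} := by
    ext le
    refine and_congr_right fun hle => forall₂_congr fun u v => ?_
    have hpf : p u < p v ↔ f u < f v := Iff.rfl
    rw [hpf]
    constructor
    · intro h huv
      refine h ⟨f u / 2, (f v + 1) / 2, by omega, (hf u u.2 _).2 (by omega),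
        (hf v v.2 _).2 (by omega)⟩
    · rintro h ⟨i, j, hij, hui, hvj⟩
      have h1 := (hf u u.2 _).1 hui
      have h2 := (hf v v.2 _).1 hvj
      obtain hlt | heq := lt_or_eq_of_le (show f u ≤ f v by omega)
      · exact h hlt
      · have his : i ≤ s := by
          by_contra! his
          rw [hempty j (by omega)] at hvj
          simp at hvj
        obtain ⟨c, hc⟩ := Finset.card_eq_one.1 (hone i his)
        rw [hinter] at hc
        have huc : (u : V) = c := by
          rw [← Finset.mem_singleton, ← hc, Finset.mem_filter]
          exact ⟨u.2, by omega⟩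
        have hvc : (v : V) = c := by
          rw [← Finset.mem_singleton, ← hc, Finset.mem_filter]
          exact ⟨v.2, by omega⟩
        obtain rfl : u = v := Subtype.ext (huc.trans hvc.symm)
        exact hle.refl u
  rw [hset, hcount]
  refine Finset.prod_congr rfl fun k _ => congrArg Nat.factorial ?_
  rw [Fintype.card_subtype, hF, ← Finset.card_map (Function.Embedding.subtype _)]
  congr 1
  ext u
  simp [p, Fin.ext_iff, and_comm]


/-- Let `a_1, …, a_r` be an `r`-chain in an `n`-uniform hypergraph,
whose union `W` has exactly `(n−1)r + 1` vertices. Then the number of linear orders on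
`W` making the chain ordered equals `((n−1)!)² · ((n−2)!)^(r−2)`; equivalently, a
uniformly random linear order on `W` makes the chain ordered with probability
`((n−1)!)² · ((n−2)!)^(r−2) / ((n−1)r + 1)!`. -/
theorem ordered_chain_linear_order_count {V : Type*} [DecidableEq V]
    (n r : ℕ) (hn : 2 ≤ n) (hr : 2 ≤ r)
    (a : Fin r → Finset V)
    (hunif : ∀ i, (a i).card = n)
    (hchain1 : ∀ i j : Fin r, ((i : ℤ) - (j : ℤ)).natAbs = 1 → (a i ∩ a j).card = 1)
    (hchain2 : ∀ i j : Fin r, 2 ≤ ((i : ℤ) - (j : ℤ)).natAbs → a i ∩ a j = ∅)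
    (W : Finset V) (hW : W = Finset.univ.biUnion a)
    (hWcard : W.card = (n - 1) * r + 1) :
    Set.ncard {le : {x // x ∈ W} → {x // x ∈ W} → Prop |
        IsLinearOrder {x // x ∈ W} le ∧
        ∀ u v : {x // x ∈ W},
          (∃ i j : Fin r, i < j ∧ (u : V) ∈ a i ∧ (v : V) ∈ a j) → le u v}
      = (Nat.factorial (n - 1)) ^ 2 * (Nat.factorial (n - 2)) ^ (r - 2) ∧
    (Set.ncard {le : {x // x ∈ W} → {x // x ∈ W} → Prop |
        IsLinearOrder {x // x ∈ W} le ∧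
        ∀ u v : {x // x ∈ W},
          (∃ i j : Fin r, i < j ∧ (u : V) ∈ a i ∧ (v : V) ∈ a j) → le u v} : ℝ)
        / (Nat.factorial ((n - 1) * r + 1) : ℝ)
      = ((Nat.factorial (n - 1) : ℝ)) ^ 2 * ((Nat.factorial (n - 2) : ℝ)) ^ (r - 2)
        / (Nat.factorial ((n - 1) * r + 1) : ℝ) := by
  obtain ⟨s, rfl⟩ := Nat.exists_eq_add_of_le' hr
  generalize hAdef : (fun i : ℕ => if h : i < s + 2 then a ⟨i, h⟩ else ∅) = A
  have hAof : ∀ i (h : i < s + 2), A i = a ⟨i, h⟩ := fun i h => by rw [← hAdef]; exact dif_pos h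
  have hAelse : ∀ i, s + 2 ≤ i → A i = ∅ := fun i h => by
    rw [← hAdef]; exact dif_neg (by omega)
  have hmem : ∀ i u, u ∈ A i → i < s + 2 := fun i u hu => by
    by_contra! h
    rw [hAelse i h] at hu
    simp at hu
  have hcount := ncard_linearOrder_ordered_chain n s A
    (fun i h => by rw [hAof i h, hunif]) hAelse
    (fun i h => by
      rw [hAof i (by omega), hAof (i + 1) (by omega)]
      exact hchain1 _ _ (by simp))
    (fun i j hij => by
      by_cases hj : j < s + 2
      · rw [hAof i (by omega), hAof j hj, Finset.disjoint_iff_inter_eq_empty]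
        exact hchain2 _ _ (by simp only []; omega)
      · simp [hAelse j (by omega)])
    W (fun u => by
      simp only [hW, Finset.mem_biUnion, Finset.mem_univ, true_and]
      exact ⟨fun ⟨i, hi⟩ => ⟨i, by rwa [hAof i i.2]⟩,
        fun ⟨i, hi⟩ => ⟨⟨i, hmem i u hi⟩, by rwa [← hAof i]⟩⟩)
  have hiff : ∀ u v : V, (∃ i j : Fin (s + 2), i < j ∧ u ∈ a i ∧ v ∈ a j) ↔
      ∃ i j : ℕ, i < j ∧ u ∈ A i ∧ v ∈ A j := fun u v =>
    ⟨fun ⟨i, j, hij, hu, hv⟩ => ⟨i, j, hij, by rwa [hAof i i.2], by rwa [hAof j j.2]⟩,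
      fun ⟨i, j, hij, hu, hv⟩ => ⟨⟨i, hmem i u hu⟩, ⟨j, hmem j v hv⟩, hij,
        by rwa [← hAof i], by rwa [← hAof j]⟩⟩
  simp only [hiff]
  rw [hcount]
  exact ⟨by simp, by simp⟩
end

section
/- Fix n ≥ 2 and let f(N) denote the maximal possible chromatic number of an n-uniform hypergraph with N edges, with f(0) = 1. Then for every integer N > 0 and every positive integer p, f(N) ≤ max { f(a_1) + f(a_2) + ⋯ + f(a_p) : a_1, …, a_p nonnegative integers with a_1 + a_2 + ⋯ + a_p ≤ N / p^(n−1) }. -/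
/-- The chromatic number of the hypergraph with edge set `E`: the smallest `r` such that
there is a proper `r`-coloring. -/
noncomputable def hypChromatic (E : Finset (Finset ℕ)) : ℕ :=
  sInf {r : ℕ | ∃ c : ℕ → Fin r, ∀ e ∈ E, ∃ u ∈ e, ∃ v ∈ e, c u ≠ c v}

/-- `maxChromatic n N` is the maximal possible chromatic number of an `n`-uniform
hypergraph with exactly `N` edges (which is `1` for `N = 0`). -/
noncomputable def maxChromatic (n N : ℕ) : ℕ :=
  sSup {k : ℕ | ∃ E : Finset (Finset ℕ),
    (∀ e ∈ E, e.card = n) ∧ E.card = N ∧ k = hypChromatic E}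

/-- An `n`-uniform hypergraph with `n ≥ 2` can be properly colored with one color per vertex
lying on an edge, plus one color for all other vertices. -/
lemma exists_proper_coloring {n : ℕ} (hn : 2 ≤ n) {E : Finset (Finset ℕ)}
    (hE : ∀ e ∈ E, e.card = n) :
    ∃ c : ℕ → Fin (E.card * n + 1), ∀ e ∈ E, ∃ u ∈ e, ∃ v ∈ e, c u ≠ c v := by
  classical
  set V := E.biUnion id
  have hcard : V.card ≤ E.card * n + 1 :=
    (Finset.card_biUnion_le_card_mul E id n fun e he => (hE e he).le).trans (Nat.le_succ _)
  refine ⟨fun v => if h : v ∈ V then (V.equivFin ⟨v, h⟩).castLE hcard else 0, fun e he => ?_⟩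
  obtain ⟨u, hu, v, hv, huv⟩ := Finset.one_lt_card.1 (by rw [hE e he]; omega : 1 < e.card)
  have huV : u ∈ V := Finset.mem_biUnion.2 ⟨e, he, hu⟩
  have hvV : v ∈ V := Finset.mem_biUnion.2 ⟨e, he, hv⟩
  refine ⟨u, hu, v, hv, ?_⟩
  simp only [huV, hvV, dif_pos]
  intro h
  have := V.equivFin.injective (Fin.castLE_injective hcard h)
  exact huv (congrArg Subtype.val this)

lemma hypChromatic_le {E : Finset (Finset ℕ)} {r : ℕ} (c : ℕ → Fin r)
    (hc : ∀ e ∈ E, ∃ u ∈ e, ∃ v ∈ e, c u ≠ c v) : hypChromatic E ≤ r :=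
  Nat.sInf_le ⟨c, hc⟩

lemma exists_proper_coloring_hypChromatic {n : ℕ} (hn : 2 ≤ n) {E : Finset (Finset ℕ)}
    (hE : ∀ e ∈ E, e.card = n) :
    ∃ c : ℕ → Fin (hypChromatic E), ∀ e ∈ E, ∃ u ∈ e, ∃ v ∈ e, c u ≠ c v :=
  Nat.sInf_mem (s := {r : ℕ | ∃ c : ℕ → Fin r, ∀ e ∈ E, ∃ u ∈ e, ∃ v ∈ e, c u ≠ c v})
    ⟨_, exists_proper_coloring hn hE⟩

lemma hypChromatic_le_maxChromatic {n : ℕ} (hn : 2 ≤ n) {E : Finset (Finset ℕ)}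
    (hE : ∀ e ∈ E, e.card = n) : hypChromatic E ≤ maxChromatic n E.card := by
  refine le_csSup ⟨E.card * n + 1, ?_⟩ ⟨E, hE, rfl, rfl⟩
  rintro k ⟨F, hF, hFE, rfl⟩
  obtain ⟨c, hc⟩ := exists_proper_coloring hn hF
  exact hFE ▸ hypChromatic_le c hc

/-- Subhypergraphs of color-`i` monochromatic edges can be colored with disjoint palettes. -/
lemma hypChromatic_le_sum {n : ℕ} (hn : 2 ≤ n) {E : Finset (Finset ℕ)}
    (hE : ∀ e ∈ E, e.card = n) {p : ℕ} (c : ℕ → Fin p) :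
    hypChromatic E ≤ ∑ i, hypChromatic (E.filter fun e => ∀ v ∈ e, c v = i) := by
  choose d hd using fun i => exists_proper_coloring_hypChromatic hn
    (E := E.filter fun e => ∀ v ∈ e, c v = i) fun e he => hE e (Finset.mem_filter.1 he).1
  refine hypChromatic_le (fun v => finSigmaFinEquiv ⟨c v, d (c v) v⟩) fun e he => ?_
  by_contra! h
  have hsig : ∀ u ∈ e, ∀ v ∈ e,
      (⟨c u, d (c u) u⟩ : Σ i, Fin (hypChromatic (E.filter fun e => ∀ v ∈ e, c v = i)))
        = ⟨c v, d (c v) v⟩ :=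
    fun u hu v hv => finSigmaFinEquiv.injective (h u hu v hv)
  obtain ⟨w, hw⟩ : e.Nonempty := Finset.card_pos.1 (by rw [hE e he]; omega)
  have hmono : ∀ v ∈ e, c v = c w := fun v hv => congrArg Sigma.fst (hsig v hv w hw)
  obtain ⟨u, hu, v, hv, huv⟩ := hd (c w) e (Finset.mem_filter.2 ⟨he, hmono⟩)
  have h' := hsig u hu v hv
  rw [hmono u hu, hmono v hv] at h'
  exact huv (eq_of_heq (Sigma.mk.inj h').2)

/-- The number of colorings of `V` that are constantly `i` on `e ⊆ V` is `p ^ (|V| - |e|)`. -/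
lemma card_colorings_eq_on_mul_pow {p : ℕ} {V e : Finset ℕ} (he : e ⊆ V) (i : Fin p) :
    (Finset.univ.filter fun c : V → Fin p => ∀ v, v.1 ∈ e → c v = i).card * p ^ e.card
      = p ^ V.card := by
  classical
  have h : (Finset.univ.filter fun c : V → Fin p => ∀ v, v.1 ∈ e → c v = i)
      = Fintype.piFinset fun v : V => if v.1 ∈ e then {i} else Finset.univ := by
    ext c
    simp only [Finset.mem_filter, Finset.mem_univ, true_and, Fintype.mem_piFinset]
    refine forall_congr' fun v => ?_
    split_ifs with hv <;> simp [hv]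
  have h₂ : ∏ v : V, (if v.1 ∈ e then ({i} : Finset (Fin p)) else Finset.univ).card
      = ∏ v ∈ V, if v ∈ e then 1 else p := by
    rw [← Finset.prod_coe_sort V]
    refine Finset.prod_congr rfl fun v _ => ?_
    split_ifs <;> simp
  rw [h, Fintype.card_piFinset, h₂, Finset.prod_ite, Finset.prod_const_one, one_mul,
    Finset.prod_const, ← pow_add, Finset.filter_notMem_eq_sdiff,
    Finset.card_sdiff_add_card_eq_card he]

/-- Some coloring with `p` colors has at most the average number of monochromatic edges. -/
lemma exists_coloring_few_monochromatic {n : ℕ} (hn : n ≠ 0) {E : Finset (Finset ℕ)}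
    (hE : ∀ e ∈ E, e.card = n) {p : ℕ} (hp : 0 < p) :
    ∃ c : ℕ → Fin p,
      (∑ i, (E.filter fun e => ∀ v ∈ e, c v = i).card) * p ^ (n - 1) ≤ E.card := by
  classical
  have : NeZero p := ⟨hp.ne'⟩
  set V := E.biUnion id
  have hsub : ∀ e ∈ E, e ⊆ V := fun e he => Finset.subset_biUnion_of_mem id he
  obtain ⟨c, -, hc⟩ : ∃ c ∈ (Finset.univ : Finset (V → Fin p)),
      (∑ i, (E.filter fun e => ∀ v : V, v.1 ∈ e → c v = i).card) * p ^ (n - 1) ≤ E.card := by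
    refine Finset.exists_le_of_sum_le Finset.univ_nonempty (le_of_eq ?_)
    calc ∑ c : V → Fin p,
          (∑ i, (E.filter fun e => ∀ v : V, v.1 ∈ e → c v = i).card) * p ^ (n - 1)
        = (∑ i, ∑ e ∈ E,
            (Finset.univ.filter fun c : V → Fin p => ∀ v, v.1 ∈ e → c v = i).card)
              * p ^ (n - 1) := by
          rw [← Finset.sum_mul, Finset.sum_comm]
          simp only [Finset.card_filter]
          congr 1
          exact Finset.sum_congr rfl fun i _ => Finset.sum_comm
      _ = ∑ e ∈ E, p ^ V.card := by
          rw [Finset.sum_comm, Finset.sum_mul]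
          refine Finset.sum_congr rfl fun e he => Nat.eq_of_mul_eq_mul_right hp ?_
          rw [mul_assoc, pow_sub_one_mul hn, Finset.sum_mul]
          simp_rw [← hE e he, card_colorings_eq_on_mul_pow (hsub e he)]
          simp [mul_comm]
      _ = ∑ _c : V → Fin p, E.card := by
          simp [mul_comm]
  refine ⟨fun v => if h : v ∈ V then c ⟨v, h⟩ else 0, le_of_eq_of_le ?_ hc⟩
  congr 1
  refine Finset.sum_congr rfl fun i _ => congrArg _ (Finset.filter_congr fun e he => ?_)
  refine ⟨fun h v hv => by simpa using h v hv, fun h v hv => ?_⟩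
  simp only [dif_pos (hsub e he hv)]
  exact h ⟨v, hsub e he hv⟩ hv

/-- The sums `f(a_1) + ⋯ + f(a_p)` with `a_1 + ⋯ + a_p` bounded form a bounded set. -/
lemma bddAbove_sums_of_sum_le {p N : ℕ} (f : ℕ → ℕ) :
    BddAbove {s : ℕ | ∃ a : Fin p → ℕ, ∑ i, a i ≤ N ∧ s = ∑ i, f (a i)} := by
  refine ⟨p * ∑ b ∈ Finset.range (N + 1), f b, ?_⟩
  rintro s ⟨a, ha, rfl⟩
  calc ∑ i, f (a i) ≤ ∑ _i : Fin p, ∑ b ∈ Finset.range (N + 1), f b :=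
        Finset.sum_le_sum fun i _ => Finset.single_le_sum (f := f) (fun _ _ => Nat.zero_le _) <|
          Finset.mem_range_succ_iff.2 <|
            (Finset.single_le_sum (fun _ _ => Nat.zero_le _) (Finset.mem_univ i)).trans ha
    _ = p * ∑ b ∈ Finset.range (N + 1), f b := by simp

/-- Cherkashin–Petrov, Lemma 1. For every `N > 0` and every positive
integer `p`,
`f(N) ≤ max { f(a_1) + ⋯ + f(a_p) : a_1 + ⋯ + a_p ≤ N / p^(n−1) }`. -/
theorem cherkashin_petrov_lemma_one (n : ℕ) (hn : 2 ≤ n) (N p : ℕ)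
    (hN : 0 < N) (hp : 0 < p) :
    maxChromatic n N ≤ sSup {s : ℕ | ∃ a : Fin p → ℕ,
      ((∑ i, a i : ℕ) : ℝ) ≤ (N : ℝ) / (p : ℝ) ^ (n - 1) ∧
      s = ∑ i, maxChromatic n (a i)} := by
  have hpow : (0 : ℝ) < (p : ℝ) ^ (n - 1) := by positivity
  refine csSup_le' ?_
  rintro k ⟨E, hE, rfl, rfl⟩
  obtain ⟨c, hc⟩ := exists_coloring_few_monochromatic (by omega) hE hp
  calc hypChromatic E ≤ ∑ i, hypChromatic (E.filter fun e => ∀ v ∈ e, c v = i) :=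
        hypChromatic_le_sum hn hE c
    _ ≤ ∑ i, maxChromatic n (E.filter fun e => ∀ v ∈ e, c v = i).card :=
        Finset.sum_le_sum fun i _ => hypChromatic_le_maxChromatic hn fun e he =>
          hE e (Finset.mem_filter.1 he).1
    _ ≤ _ := by
        refine le_csSup ?_ ⟨fun i => (E.filter fun e => ∀ v ∈ e, c v = i).card, ?_, rfl⟩
        · refine (bddAbove_sums_of_sum_le (p := p) (N := E.card) (maxChromatic n)).mono ?_
          rintro s ⟨a, ha, rfl⟩
          refine ⟨a, ?_, rfl⟩
          rw [le_div_iff₀ hpow] at ha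
          exact (Nat.le_mul_of_pos_right _ (pow_pos hp (n - 1))).trans (by exact_mod_cast ha)
        · rw [le_div_iff₀ hpow]
          exact_mod_cast hc
end

section
/- liminf over r → ∞ of m(3, r)/r³ is at least 4/e³; equivalently, for every ε > 0 there exists r₀ such that for all integers r ≥ r₀, m(3, r) ≥ (4/e³ − ε) · r³. -/
open Finset in
/-- Among all `a`-colorings of a finite type, at most a fraction `1 / a ^ 2` is constant on three
given distinct points. -/
theorem card_filter_monochromatic_triple_mul_sq_le {V : Type*} [Fintype V] [DecidableEq V] (a : ℕ)
    {x y z : V} (hxy : x ≠ y) (hxz : x ≠ z) (hyz : y ≠ z) :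
    #{f : V → Fin a | f x = f y ∧ f x = f z} * a ^ 2 ≤ Fintype.card (V → Fin a) := by
  have hcard : #{f : V → Fin a | f x = f y ∧ f x = f z} * a ^ 2 =
      #(({f : V → Fin a | f x = f y ∧ f x = f z} : Finset (V → Fin a)) ×ˢ
        (univ : Finset (Fin a × Fin a))) := by
    simp [card_product, sq]
  rw [hcard, ← card_univ]
  refine card_le_card_of_injOn
    (fun p ↦ Function.update (Function.update p.1 y p.2.1) z p.2.2) (by simp) ?_
  rintro ⟨f, i, j⟩ hf ⟨g, k, l⟩ hg h
  simp only [coe_product, Set.mem_prod, coe_filter, mem_univ, true_and, Set.mem_ofPred_eq,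
    coe_univ, Set.mem_univ, and_true] at hf hg
  have hv (v : V) := congrFun h v
  have hx := hv x
  have hy := hv y
  have hz := hv z
  simp only [Function.update_apply, hxy, hxz, hyz, if_true, if_false] at hx hy hz
  have hfg : f = g := by
    funext v
    have := hv v
    simp only [Function.update_apply] at this
    grind
  simp [hfg, hy, hz]

open Finset in
/-- Every 3-uniform hypergraph has an `a`-coloring for which at most a fraction `1 / a ^ 2` of the
edges is monochromatic. -/
theorem exists_coloring_card_monochromatic_mul_sq_le (a : ℕ) (ha : 0 < a)
    (E : Finset (Finset ℕ)) (hE : ∀ e ∈ E, e.card = 3) :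
    ∃ c : ℕ → Fin a, #{e ∈ E | ∀ u ∈ e, ∀ v ∈ e, c u = c v} * a ^ 2 ≤ #E := by
  have : NeZero a := ⟨ha.ne'⟩
  obtain ⟨V, hV⟩ : ∃ V : Finset ℕ, ∀ e ∈ E, e ⊆ V :=
    ⟨E.sup id, fun e he ↦ le_sup (f := id) he⟩
  let ext (f : V → Fin a) (n : ℕ) : Fin a := if h : n ∈ V then f ⟨n, h⟩ else 0
  have hedge : ∀ e ∈ E, #{f : V → Fin a | ∀ u ∈ e, ∀ v ∈ e, ext f u = ext f v} * a ^ 2 ≤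
      Fintype.card (V → Fin a) := by
    intro e he
    obtain ⟨x, y, z, hxy, hxz, hyz, rfl⟩ := card_eq_three.mp (hE e he)
    have hsub : ({x, y, z} : Finset ℕ) ⊆ V := hV _ he
    have hx : x ∈ V := hsub (by simp)
    have hy : y ∈ V := hsub (by simp)
    have hz : z ∈ V := hsub (by simp)
    refine le_trans (Nat.mul_le_mul_right _ (card_le_card ?_))
      (card_filter_monochromatic_triple_mul_sq_le a
        (x := (⟨x, hx⟩ : V)) (y := ⟨y, hy⟩) (z := ⟨z, hz⟩)
        (by simpa using hxy) (by simpa using hxz) (by simpa using hyz))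
    intro f hf
    simp only [mem_filter, mem_univ, true_and] at hf ⊢
    have h₁ := hf x (by simp) y (by simp)
    have h₂ := hf x (by simp) z (by simp)
    simp only [ext, dif_pos hx, dif_pos hy, dif_pos hz] at h₁ h₂
    exact ⟨h₁, h₂⟩
  have hsum : ∑ f : V → Fin a,
      #{e ∈ E | ∀ u ∈ e, ∀ v ∈ e, ext f u = ext f v} * a ^ 2 ≤
      ∑ _f : V → Fin a, #E := by
    rw [← sum_mul]
    simp only [card_filter]
    rw [sum_comm]
    rw [sum_mul]
    refine (sum_le_sum fun e he ↦ ?_).trans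
      (b := ∑ _e ∈ E, Fintype.card (V → Fin a)) (by simp [mul_comm])
    simpa only [card_filter] using hedge e he
  obtain ⟨f, -, hf⟩ := exists_le_of_sum_le univ_nonempty hsum
  exact ⟨ext f, hf⟩

open Finset in
/-- A 3-uniform hypergraph with at most `2 * b * a ^ 2` edges is properly colorable with `a + b`
colors: take an `a`-coloring with few monochromatic edges and recolor one vertex of each of them,
using each of the `b` new colors at most twice. -/
theorem exists_proper_coloring_of_card_le (a b : ℕ) (ha : 0 < a)
    (E : Finset (Finset ℕ)) (hE : ∀ e ∈ E, e.card = 3) (hcard : #E ≤ 2 * b * a ^ 2) :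
    ∃ c : ℕ → Fin (a + b), ∀ e ∈ E, ∃ u ∈ e, ∃ v ∈ e, c u ≠ c v := by
  obtain ⟨c, hc⟩ := exists_coloring_card_monochromatic_mul_sq_le a ha E hE
  set M := {e ∈ E | ∀ u ∈ e, ∀ v ∈ e, c u = c v}
  have hMb : #M ≤ 2 * b := Nat.le_of_mul_le_mul_right (hc.trans hcard) (by positivity)
  have hne : ∀ e ∈ E, ∃ v, v ∈ e := fun e he ↦
    card_pos.mp (by rw [hE e he]; norm_num)
  choose! g hg using hne
  set R := M.image g
  have hR : #R ≤ 2 * b := card_image_le.trans hMb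
  let d (n : ℕ) : ℕ := if h : n ∈ R then a + (R.equivFin ⟨n, h⟩ : ℕ) / 2 else c n
  have hd (n : ℕ) : d n < a + b := by
    by_cases h : n ∈ R
    · have := (R.equivFin ⟨n, h⟩).isLt
      simp only [d, dif_pos h]
      omega
    · have := (c n).isLt
      simp only [d, dif_neg h]
      omega
  refine ⟨fun n ↦ ⟨d n, hd n⟩, fun e he ↦ ?_⟩
  by_contra! hmono
  simp only [Fin.mk.injEq] at hmono
  by_cases hmeet : ∃ u ∈ e, u ∈ R
  · obtain ⟨u, hu, huR⟩ := hmeet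
    have hsub : ∀ v ∈ e, v ∈ R := by
      intro v hv
      by_contra hvR
      have h := hmono u hu v hv
      have := (c v).isLt
      simp only [d, dif_pos huR, dif_neg hvR] at h
      omega
    obtain ⟨x, y, z, hxy, hxz, hyz, rfl⟩ := card_eq_three.mp (hE e he)
    have hx := hsub x (by simp)
    have hy := hsub y (by simp)
    have hz := hsub z (by simp)
    have h₁ := hmono x (by simp) y (by simp)
    have h₂ := hmono x (by simp) z (by simp)
    simp only [d, dif_pos hx, dif_pos hy, dif_pos hz] at h₁ h₂
    have index_ne {v w : ℕ} (hv : v ∈ R) (hw : w ∈ R) (hvw : v ≠ w) :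
        (R.equivFin ⟨v, hv⟩ : ℕ) ≠ R.equivFin ⟨w, hw⟩ := by
      simpa [Fin.val_inj] using hvw
    have := index_ne hx hy hxy
    have := index_ne hx hz hxz
    have := index_ne hy hz hyz
    omega
  · push Not at hmeet
    have heM : e ∈ M := by
      refine mem_filter.mpr ⟨he, fun u hu v hv ↦ ?_⟩
      have h := hmono u hu v hv
      simp only [d, dif_neg (hmeet u hu), dif_neg (hmeet v hv)] at h
      exact Fin.ext h
    exact hmeet (g e) (hg e he) (mem_image_of_mem g heM)

open Finset in
/-- The complete 3-uniform hypergraph on `2 * r + 1` vertices has no proper `r`-coloring. -/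
theorem not_exists_proper_coloring_powersetCard_three (r : ℕ) :
    ¬ ∃ c : ℕ → Fin r, ∀ e ∈ powersetCard 3 (range (2 * r + 1)),
      ∃ u ∈ e, ∃ v ∈ e, c u ≠ c v := by
  rintro ⟨c, hc⟩
  obtain ⟨k, -, hk⟩ := exists_lt_card_fiber_of_mul_lt_card_of_maps_to
    (s := range (2 * r + 1)) (t := univ) (f := c) (n := 2) (by simp) (by simp; omega)
  obtain ⟨e, he, hcard⟩ := exists_subset_card_eq (Nat.succ_le_of_lt hk)
  obtain ⟨u, hu, v, hv, huv⟩ :=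
    hc e (mem_powersetCard.mpr ⟨he.trans (filter_subset _ _), hcard⟩)
  exact huv ((mem_filter.mp (he hu)).2.trans (mem_filter.mp (he hv)).2.symm)

theorem lt_minNonColorable_three (a b : ℕ) (ha : 0 < a) :
    2 * b * a ^ 2 < minNonColorable 3 (a + b) := by
  obtain ⟨E, hE, hcard, hcol⟩ := Nat.sInf_mem (s := {N : ℕ | ∃ E : Finset (Finset ℕ),
      (∀ e ∈ E, e.card = 3) ∧ E.card = N ∧
      ¬ ∃ c : ℕ → Fin (a + b), ∀ e ∈ E, ∃ u ∈ e, ∃ v ∈ e, c u ≠ c v})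
    ⟨_, _, fun e he ↦ (Finset.mem_powersetCard.mp he).2, rfl,
      not_exists_proper_coloring_powersetCard_three (a + b)⟩
  by_contra! hle
  exact hcol (exists_proper_coloring_of_card_le a b ha E hE (hcard.trans_le hle))

/-- `liminf_{r→∞} m(3, r)/r³ ≥ 4/e³`; equivalently, for every `ε > 0`
there exists `r₀` such that for all `r ≥ r₀`, `m(3, r) ≥ (4/e³ − ε) · r³`. -/
theorem liminf_m3_ge_four_div_e_cubed :
    ∀ ε : ℝ, 0 < ε → ∃ r₀ : ℕ, ∀ r : ℕ, r₀ ≤ r →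
      (4 / Real.exp 1 ^ 3 - ε) * (r : ℝ) ^ 3 ≤ (minNonColorable 3 r : ℝ) := by
  intro ε hε
  refine ⟨20, fun r hr ↦ ?_⟩
  obtain ⟨k, hk⟩ : ∃ k, k = r / 3 := ⟨_, rfl⟩
  have hlt := lt_minNonColorable_three (2 * k) (r - 2 * k) (by omega)
  rw [show 2 * k + (r - 2 * k) = r by omega] at hlt
  have hkr : 2 * k * (2 * k) ^ 2 ≤ minNonColorable 3 r :=
    le_trans (Nat.mul_le_mul_right _ (by omega)) hlt.le
  have hkr' : (8 : ℝ) * k ^ 3 ≤ minNonColorable 3 r := by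
    have : ((2 * k * (2 * k) ^ 2 : ℕ) : ℝ) ≤ minNonColorable 3 r := by exact_mod_cast hkr
    push_cast at this
    linarith
  have h3k : (3 / 10 : ℝ) * r ≤ k := by
    have : (3 * r : ℝ) ≤ 10 * k := by
      exact_mod_cast (by omega : 3 * r ≤ 10 * k)
    linarith
  have hcube : ((3 / 10 : ℝ) * r) ^ 3 ≤ k ^ 3 := by gcongr
  have hexp : 4 / Real.exp 1 ^ 3 ≤ 27 / 125 := by
    have h : (27 / 10 : ℝ) ^ 3 ≤ Real.exp 1 ^ 3 := by
      have := Real.exp_one_gt_d9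
      gcongr
      linarith
    rw [div_le_iff₀ (by positivity)]
    linarith
  calc (4 / Real.exp 1 ^ 3 - ε) * (r : ℝ) ^ 3 ≤ 27 / 125 * (r : ℝ) ^ 3 := by
        gcongr
        linarith
    _ = 8 * ((3 / 10 : ℝ) * r) ^ 3 := by ring
    _ ≤ 8 * k ^ 3 := by gcongr
    _ ≤ minNonColorable 3 r := hkr'
end
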